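/- arXiv:1902.00402 — 6 statements merged into one kernel-verified Lean document; each statement's English description precedes it below -/
import Mathlib

section
/- For every real γ ≥ 2 there exists a constant C > 0 (depending only on γ) such that for all real s ≥ 0 one has (s − 1)² ≤ C·(s^γ − 1 − γ·(s − 1)). -/
/-- Bernoulli's inequality for `s ^ 2` with exponent `γ / 2`: the remainder of the first-order
expansion of `s ^ γ` at `1` is at least `γ / 2 * (s - 1) ^ 2`. -/
theorem half_mul_sub_one_sq_le_rpow_sub {γ s : ℝ} (hγ : 2 ≤ γ) (hs : 0 ≤ s) :
    γ / 2 * (s - 1) ^ 2 ≤ s ^ γ - 1 - γ * (s - 1) := by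
  have bernoulli : 1 + γ / 2 * (s ^ 2 - 1) ≤ (1 + (s ^ 2 - 1)) ^ (γ / 2) :=
    one_add_mul_self_le_rpow_one_add (by nlinarith [sq_nonneg s]) (by linarith)
  have rpow_eq : (1 + (s ^ 2 - 1)) ^ (γ / 2) = s ^ γ := by
    rw [add_sub_cancel, ← Real.rpow_natCast_mul hs]
    congr 1
    push_cast
    ring
  rw [rpow_eq] at bernoulli
  linarith

/-- For every real `γ ≥ 2` there exists `C > 0` (depending only on `γ`) such that
for all `s ≥ 0`, `(s - 1)² ≤ C * (s^γ - 1 - γ*(s - 1))`. -/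
theorem stmt_0 (γ : ℝ) (hγ : 2 ≤ γ) :
    ∃ C : ℝ, 0 < C ∧ ∀ s : ℝ, 0 ≤ s →
      (s - 1) ^ 2 ≤ C * (s ^ γ - 1 - γ * (s - 1)) := by
  refine ⟨1, one_pos, fun s hs => ?_⟩
  rw [one_mul]
  refine le_trans ?_ (half_mul_sub_one_sq_le_rpow_sub hγ hs)
  exact le_mul_of_one_le_left (sq_nonneg _) (by linarith)
end

section
/- For every real γ with 1 < γ < 2 there exists a constant c > 0 (depending only on γ) such that for all real s ≥ 0: if |s − 1| ≤ 1/2 then c·(s − 1)² ≤ s^γ − 1 − γ·(s − 1), and if |s − 1| > 1/2 then c·|s − 1|^γ ≤ s^γ − 1 − γ·(s − 1). -/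
/-- A quadratic lower bound for the Bernoulli gap `s ^ γ - 1 - γ * (s - 1)`, valid for all
`s ≥ 0`. -/
lemma sq_div_le_rpow_sub_one_sub_mul {γ s : ℝ} (hγ1 : 1 < γ) (hγ2 : γ < 2) (hs : 0 ≤ s) :
    (γ - 1) ^ 2 * (s - 1) ^ 2 / (1 + (2 - γ) * (s - 1)) ≤ s ^ γ - 1 - γ * (s - 1) := by
  have hden : 0 < 1 + (2 - γ) * (s - 1) := by nlinarith [mul_nonneg (sub_pos.2 hγ2).le hs]
  have key : s ^ 2 ≤ s ^ γ * (1 + (2 - γ) * (s - 1)) := by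
    have h := rpow_one_add_le_one_add_mul_self (s := s - 1) (by linarith)
      (sub_pos.2 hγ2).le (by linarith : 2 - γ ≤ 1)
    rw [add_sub_cancel] at h
    calc s ^ 2 = s ^ γ * s ^ (2 - γ) := by
          rw [← Real.rpow_add_of_nonneg hs (by linarith) (by linarith), add_sub_cancel]
          norm_cast
      _ ≤ _ := mul_le_mul_of_nonneg_left h (Real.rpow_nonneg hs γ)
  rw [div_le_iff₀ hden]
  linear_combination key

/-- For large `s`, the Bernoulli gap dominates half of `(s - 1) ^ γ`. -/
lemma half_rpow_le_rpow_sub_one_sub_mul {γ t : ℝ} (hγ1 : 1 < γ) (hγ2 : γ < 2)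
    (ht : (6 : ℝ) ^ (γ - 1)⁻¹ ≤ t) :
    1 / 2 * t ^ γ ≤ (1 + t) ^ γ - 1 - γ * t := by
  have hγ : 0 < γ - 1 := by linarith
  have ht1 : 1 ≤ t := (Real.one_le_rpow (by norm_num) (inv_pos.2 hγ).le).trans ht
  have h6 : 6 ≤ t ^ (γ - 1) := by
    rwa [← Real.rpow_inv_le_iff_of_pos (by norm_num) (by linarith) hγ]
  have hmul : t ^ γ = t ^ (γ - 1) * t := by
    rw [← Real.rpow_add_one (by linarith), sub_add_cancel]
  have hmono : t ^ γ ≤ (1 + t) ^ γ :=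
    Real.rpow_le_rpow (by linarith) (by linarith) (by linarith)
  nlinarith

/-- For `1 < γ < 2` there exists `c > 0` such that for all `s ≥ 0`:
if `|s - 1| ≤ 1/2` then `c·(s-1)² ≤ s^γ - 1 - γ(s-1)`, and
if `|s - 1| > 1/2` then `c·|s-1|^γ ≤ s^γ - 1 - γ(s-1)`. -/
theorem stmt_1 (γ : ℝ) (hγ1 : 1 < γ) (hγ2 : γ < 2) :
    ∃ c : ℝ, 0 < c ∧ ∀ s : ℝ, 0 ≤ s →
      (|s - 1| ≤ 1 / 2 → c * (s - 1) ^ 2 ≤ s ^ γ - 1 - γ * (s - 1)) ∧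
      (1 / 2 < |s - 1| → c * |s - 1| ^ γ ≤ s ^ γ - 1 - γ * (s - 1)) := by
  have hγ : 0 < γ - 1 := by linarith
  obtain ⟨T, hT⟩ : ∃ T, T = (6 : ℝ) ^ (γ - 1)⁻¹ := ⟨_, rfl⟩
  have hT1 : 1 < T := hT ▸ Real.one_lt_rpow (by norm_num) (inv_pos.2 hγ)
  have hTγ : 1 ≤ T ^ γ := Real.one_le_rpow hT1.le (by linarith)
  have hD : 2 ≤ (1 + T) * T ^ γ := by nlinarith
  have hsq : 0 < (γ - 1) ^ 2 := by positivity
  refine ⟨(γ - 1) ^ 2 / (4 * ((1 + T) * T ^ γ)), by positivity, fun s hs ↦ ?_⟩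
  have hquad := sq_div_le_rpow_sub_one_sub_mul hγ1 hγ2 hs
  have hden : 0 < 1 + (2 - γ) * (s - 1) := by nlinarith [mul_nonneg (sub_pos.2 hγ2).le hs]
  refine ⟨fun h ↦ le_trans ?_ hquad, fun h ↦ ?_⟩
  · rw [div_mul_eq_mul_div]
    have := (abs_le.1 h).2
    exact div_le_div_of_nonneg_left (by positivity) hden (by nlinarith)
  · rcases le_total T |s - 1| with hTs | hTs
    · have ht : T ≤ s - 1 := by
        rcases le_abs.1 hTs with h' | h'
        · exact h'
        · linarith
      have hlarge := half_rpow_le_rpow_sub_one_sub_mul hγ1 hγ2 (hT ▸ ht)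
      rw [add_sub_cancel] at hlarge
      rw [abs_of_nonneg (by linarith)]
      refine le_trans (mul_le_mul_of_nonneg_right ?_ (Real.rpow_nonneg (by linarith) γ)) hlarge
      rw [div_le_iff₀ (by positivity)]
      nlinarith
    · refine le_trans ?_ hquad
      have hpow : |s - 1| ^ γ ≤ T ^ γ := Real.rpow_le_rpow (abs_nonneg _) hTs (by linarith)
      have hsT : 1 + (2 - γ) * (s - 1) ≤ 1 + T := by nlinarith [le_abs_self (s - 1)]
      have hquarter : 1 / 4 ≤ (s - 1) ^ 2 := by nlinarith [sq_abs (s - 1)]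
      calc (γ - 1) ^ 2 / (4 * ((1 + T) * T ^ γ)) * |s - 1| ^ γ
          ≤ (γ - 1) ^ 2 / (4 * ((1 + T) * T ^ γ)) * T ^ γ := by gcongr
        _ = (γ - 1) ^ 2 * (1 / 4) / (1 + T) := by field_simp
        _ ≤ (γ - 1) ^ 2 * (s - 1) ^ 2 / (1 + (2 - γ) * (s - 1)) := by gcongr
end

section
/- Let κ > 0 and φ_κ(r) = r·√(1 + κ²r²). For every natural number k there exists a constant C_k > 0 (depending on k and κ) such that for all r > 0, |φ_κ^{(k+1)}(r)| ≤ C_k · φ_κ′(r)/r^k, where φ_κ^{(k+1)} denotes the (k+1)-st derivative of φ_κ. -/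
/-- The radial profile `φ_κ(r) = r·√(1 + κ²r²)` of the Bogoliubov dispersion relation. -/
noncomputable def bogoliubovPhase (κ : ℝ) : ℝ → ℝ := fun r => r * Real.sqrt (1 + κ ^ 2 * r ^ 2)

theorem one_add_mul_sq_pos (κ r : ℝ) : 0 < 1 + κ ^ 2 * r ^ 2 := by positivity

theorem hasDerivAt_sqrt_one_add_mul_sq (κ r : ℝ) :
    HasDerivAt (fun r : ℝ => √(1 + κ ^ 2 * r ^ 2)) (κ ^ 2 * r / √(1 + κ ^ 2 * r ^ 2)) r := by
  have h : HasDerivAt (fun r : ℝ => 1 + κ ^ 2 * r ^ 2) (κ ^ 2 * (2 * r)) r := by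
    simpa using ((hasDerivAt_pow 2 r).const_mul (κ ^ 2)).const_add 1
  convert h.sqrt (one_add_mul_sq_pos κ r).ne' using 1
  field_simp

theorem hasDerivAt_bogoliubovPhase (κ r : ℝ) :
    HasDerivAt (bogoliubovPhase κ) ((1 + 2 * κ ^ 2 * r ^ 2) / √(1 + κ ^ 2 * r ^ 2)) r := by
  have hS := Real.sqrt_pos.2 (one_add_mul_sq_pos κ r)
  refine ((hasDerivAt_id' r).mul (hasDerivAt_sqrt_one_add_mul_sq κ r)).congr_deriv ?_
  field_simp
  rw [Real.sq_sqrt (one_add_mul_sq_pos κ r).le]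
  ring

/-- Differentiating a polynomial over a power of `√(1 + κ²r²)` gives a function of the same
form. -/
theorem hasDerivAt_eval_div_sqrt_pow (κ : ℝ) (P : Polynomial ℝ) (n : ℕ) (r : ℝ) :
    HasDerivAt (fun r => P.eval r / √(1 + κ ^ 2 * r ^ 2) ^ n)
      ((P.derivative * (1 + Polynomial.C (κ ^ 2) * Polynomial.X ^ 2) -
        Polynomial.C (n * κ ^ 2) * Polynomial.X * P).eval r /
        √(1 + κ ^ 2 * r ^ 2) ^ (n + 2)) r := by
  have hS := Real.sqrt_pos.2 (one_add_mul_sq_pos κ r)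
  refine ((P.hasDerivAt r).div ((hasDerivAt_sqrt_one_add_mul_sq κ r).pow n)
    (pow_pos hS n).ne').congr_deriv ?_
  have h2 := Real.sq_sqrt (one_add_mul_sq_pos κ r).le
  simp only [Polynomial.eval_sub, Polynomial.eval_mul, Polynomial.eval_add, Polynomial.eval_one,
    Polynomial.eval_C, Polynomial.eval_pow, Polynomial.eval_X, Pi.pow_apply]
  generalize √(1 + κ ^ 2 * r ^ 2) = S at *
  rw [← h2]
  rcases n with _ | n
  · simp
    field_simp
  · simp only [Nat.add_sub_cancel]
    field_simp
    ring

theorem exists_iteratedDeriv_bogoliubovPhase_eq (κ : ℝ) (k : ℕ) :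
    ∃ P : Polynomial ℝ, P.natDegree ≤ k + 2 ∧
      iteratedDeriv (k + 1) (bogoliubovPhase κ) =
        fun r => P.eval r / √(1 + κ ^ 2 * r ^ 2) ^ (2 * k + 1) := by
  induction k with
  | zero =>
    refine ⟨1 + Polynomial.C (2 * κ ^ 2) * Polynomial.X ^ 2, by compute_degree, ?_⟩
    funext r
    simp [iteratedDeriv_one, (hasDerivAt_bogoliubovPhase κ r).deriv]
  | succ k ih =>
    obtain ⟨P, hP, h⟩ := ih
    refine ⟨P.derivative * (1 + Polynomial.C (κ ^ 2) * Polynomial.X ^ 2) -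
      Polynomial.C ((2 * k + 1 : ℕ) * κ ^ 2) * Polynomial.X * P, ?_, funext fun r => ?_⟩
    · refine (Polynomial.natDegree_sub_le _ _).trans (max_le ?_ ?_)
      · refine Polynomial.natDegree_mul_le_of_le (m := k + 1) (n := 2)
          ((Polynomial.natDegree_derivative_le P).trans (by omega)) (by compute_degree)
      · exact (Polynomial.natDegree_mul_le_of_le (m := 1) (by compute_degree) hP).trans (by omega)
    · rw [iteratedDeriv_succ, h]
      exact (hasDerivAt_eval_div_sqrt_pow κ P (2 * k + 1) r).deriv

theorem one_le_sqrt_one_add_mul_sq (κ r : ℝ) : 1 ≤ √(1 + κ ^ 2 * r ^ 2) :=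
  Real.one_le_sqrt.2 (by nlinarith [sq_nonneg (κ * r)])

theorem le_inv_mul_sqrt_one_add_mul_sq {κ : ℝ} (hκ : 0 < κ) (r : ℝ) :
    r ≤ κ⁻¹ * √(1 + κ ^ 2 * r ^ 2) := by
  rw [le_inv_mul_iff₀ hκ]
  exact Real.le_sqrt_of_sq_le (by nlinarith)

theorem pow_le_inv_pow_mul_sqrt_pow {κ : ℝ} (hκ : 0 < κ) {r : ℝ} (hr : 0 ≤ r) (n : ℕ) :
    r ^ n ≤ κ⁻¹ ^ n * √(1 + κ ^ 2 * r ^ 2) ^ n := by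
  rw [← mul_pow]
  exact pow_le_pow_left₀ hr (le_inv_mul_sqrt_one_add_mul_sq hκ r) n

theorem exists_abs_eval_le_sqrt_pow {κ : ℝ} (hκ : 0 < κ) (P : Polynomial ℝ) {n : ℕ}
    (hP : P.natDegree ≤ n) :
    ∃ C : ℝ, 0 < C ∧ ∀ r : ℝ, 0 ≤ r → |P.eval r| ≤ C * √(1 + κ ^ 2 * r ^ 2) ^ n := by
  refine ⟨(∑ i ∈ Finset.range (n + 1), |P.coeff i| * κ⁻¹ ^ i) + 1, by positivity,
    fun r hr => ?_⟩
  have hS := one_le_sqrt_one_add_mul_sq κ r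
  rw [Polynomial.eval_eq_sum_range' (Nat.lt_succ_of_le hP)]
  calc |∑ i ∈ Finset.range (n + 1), P.coeff i * r ^ i|
      ≤ ∑ i ∈ Finset.range (n + 1), |P.coeff i * r ^ i| := Finset.abs_sum_le_sum_abs _ _
    _ ≤ ∑ i ∈ Finset.range (n + 1), |P.coeff i| * κ⁻¹ ^ i * √(1 + κ ^ 2 * r ^ 2) ^ n := by
        refine Finset.sum_le_sum fun i hi => ?_
        rw [abs_mul, abs_of_nonneg (pow_nonneg hr i), mul_assoc]
        gcongr
        refine (pow_le_inv_pow_mul_sqrt_pow hκ hr i).trans ?_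
        gcongr
        exact Nat.lt_succ_iff.1 (Finset.mem_range.1 hi)
    _ ≤ _ := by
        rw [← Finset.sum_mul]
        gcongr
        linarith

theorem sqrt_le_deriv_bogoliubovPhase (κ r : ℝ) :
    √(1 + κ ^ 2 * r ^ 2) ≤ deriv (bogoliubovPhase κ) r := by
  rw [(hasDerivAt_bogoliubovPhase κ r).deriv,
    le_div_iff₀ (Real.sqrt_pos.2 (one_add_mul_sq_pos κ r)),
    Real.mul_self_sqrt (one_add_mul_sq_pos κ r).le]
  nlinarith [sq_nonneg (κ * r)]

/-- Symbol-type derivative bounds: for each `k` there is `C_k > 0` with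
`|φ_κ^{(k+1)}(r)| ≤ C_k · φ_κ′(r)/r^k` for all `r > 0`. -/
theorem stmt_9 (κ : ℝ) (hκ : 0 < κ) (k : ℕ) :
    ∃ C : ℝ, 0 < C ∧ ∀ r : ℝ, 0 < r →
      |iteratedDeriv (k + 1) (bogoliubovPhase κ) r| ≤
        C * deriv (bogoliubovPhase κ) r / r ^ k := by
  obtain ⟨P, hP, h⟩ := exists_iteratedDeriv_bogoliubovPhase_eq κ k
  obtain ⟨C, hC, hle⟩ := exists_abs_eval_le_sqrt_pow hκ P hP
  refine ⟨C * κ⁻¹ ^ k, by positivity, fun r hr => ?_⟩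
  have hφ := sqrt_le_deriv_bogoliubovPhase κ r
  have hrk := pow_le_inv_pow_mul_sqrt_pow hκ hr.le k
  have hPr := hle r hr.le
  have hS := Real.sqrt_pos.2 (one_add_mul_sq_pos κ r)
  rw [h]
  simp only
  generalize √(1 + κ ^ 2 * r ^ 2) = S at *
  rw [abs_div, abs_of_pos (pow_pos hS _), div_le_div_iff₀ (by positivity) (by positivity)]
  calc |P.eval r| * r ^ k ≤ C * S ^ (k + 2) * (κ⁻¹ ^ k * S ^ k) := by gcongr
    _ = C * κ⁻¹ ^ k * S * S ^ (2 * k + 1) := by ring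
    _ ≤ _ := by gcongr
end

section
/- Let d ≥ 1 be an integer and let φ : ℝ → ℝ be twice continuously differentiable on (0, ∞). Define F : ℝ^d → ℝ by F(ξ) = φ(‖ξ‖), where ‖·‖ is the Euclidean norm. Then for every ξ ≠ 0, F is twice differentiable at ξ and the determinant of the Hessian matrix (∂²F/∂ξ_i∂ξ_j(ξ))_{i,j} equals (φ′(‖ξ‖)/‖ξ‖)^{d−1} · φ″(‖ξ‖). -/
open scoped Topology

/-- The determinant of a scalar matrix plus a symmetric rank-one matrix. -/
theorem Matrix.det_scalar_add_smul_vecMulVec_self {n R : Type*} [Fintype n] [DecidableEq n]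
    [Nonempty n] [CommRing R] (a b : R) (v : n → R) :
    (Matrix.scalar n a + b • Matrix.vecMulVec v v).det =
      a ^ (Fintype.card n - 1) * (a + b * (v ⬝ᵥ v)) := by
  have h := Matrix.eval_charpoly (Matrix.vecMulVec (-b • v) v) a
  rw [Matrix.charpoly_vecMulVec, Matrix.smul_vecMulVec, neg_smul (M := Matrix n n R),
    sub_neg_eq_add] at h
  rw [← h]
  obtain ⟨k, hk⟩ := Nat.exists_eq_succ_of_ne_zero (Fintype.card_ne_zero (α := n))
  simp [hk, pow_succ]
  ring

section

variable {E : Type*} [NormedAddCommGroup E] [InnerProductSpace ℝ E]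

/-- The Fréchet derivative of a radial function away from the origin. -/
theorem HasDerivAt.hasFDerivAt_comp_norm {f : ℝ → ℝ} {f' : ℝ} {x : E}
    (hf : HasDerivAt f f' ‖x‖) (hx : x ≠ 0) :
    HasFDerivAt (fun y : E => f ‖y‖) ((f' / ‖x‖) • innerSL ℝ x) x := by
  have hx' : ‖x‖ ≠ 0 := norm_ne_zero_iff.mpr hx
  have h := (hasStrictFDerivAt_norm_sq x).hasFDerivAt.sqrt (pow_ne_zero 2 hx')
  simp only [Real.sqrt_sq (norm_nonneg _)] at h
  refine (hf.comp_hasFDerivAt x h).congr_fderiv ?_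
  ext y
  simp
  field_simp

/-- The second Fréchet derivative of a radial function away from the origin. -/
theorem iteratedFDeriv_two_comp_norm_apply {φ : ℝ → ℝ} (hφ : ContDiffOn ℝ 2 φ (Set.Ioi 0))
    {x : E} (hx : x ≠ 0) (u v : E) :
    iteratedFDeriv ℝ 2 (fun y : E => φ ‖y‖) x ![u, v] =
      deriv φ ‖x‖ / ‖x‖ * inner ℝ u v +
        (deriv (deriv φ) ‖x‖ - deriv φ ‖x‖ / ‖x‖) / ‖x‖ ^ 2 * (inner ℝ x u * inner ℝ x v) := by
  have hx' : ‖x‖ ≠ 0 := norm_ne_zero_iff.mpr hx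
  have h_first : fderiv ℝ (fun y : E => φ ‖y‖) =ᶠ[𝓝 x]
      fun y => (deriv φ ‖y‖ / ‖y‖) • innerSL ℝ y := by
    filter_upwards [isOpen_ne.mem_nhds hx] with y hy
    have hd : DifferentiableAt ℝ φ ‖y‖ :=
      (hφ.contDiffAt (Ioi_mem_nhds (norm_pos_iff.mpr hy))).differentiableAt two_ne_zero
    exact (hd.hasDerivAt.hasFDerivAt_comp_norm hy).fderiv
  have h_deriv : DifferentiableAt ℝ (deriv φ) ‖x‖ :=
    ((contDiffOn_succ_iff_deriv_of_isOpen (n := 1) isOpen_Ioi).mp hφ).2.2.contDiffAt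
      (Ioi_mem_nhds (norm_pos_iff.mpr hx)) |>.differentiableAt one_ne_zero
  have h_coeff := (h_deriv.hasDerivAt.fun_div (hasDerivAt_id' ‖x‖) hx').hasFDerivAt_comp_norm hx
  have h_inner : HasFDerivAt (fun y : E => innerSL ℝ y) (innerSL ℝ : E →L[ℝ] E →L[ℝ] ℝ) x :=
    (innerSL ℝ : E →L[ℝ] E →L[ℝ] ℝ).hasFDerivAt
  rw [iteratedFDeriv_two_apply, h_first.fderiv_eq, (h_coeff.fun_smul h_inner).fderiv]
  have h_apply (y z : E) : (innerSL ℝ : E →L[ℝ] E →L[ℝ] ℝ) y z = inner ℝ y z := rfl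
  simp [h_apply]
  field_simp

end

/-- For `φ` twice continuously differentiable on `(0,∞)` and `F(ξ) = φ(‖ξ‖)` on `ℝ^d`,
at every `ξ ≠ 0` the function `F` is twice differentiable and the determinant of its
Hessian matrix equals `(φ′(‖ξ‖)/‖ξ‖)^{d−1}·φ″(‖ξ‖)`. -/
theorem stmt_11 (d : ℕ) (hd : 1 ≤ d) (φ : ℝ → ℝ)
    (hφ : ContDiffOn ℝ 2 φ (Set.Ioi 0)) :
    ∀ ξ : EuclideanSpace ℝ (Fin d), ξ ≠ 0 →
      ContDiffAt ℝ 2 (fun x : EuclideanSpace ℝ (Fin d) => φ ‖x‖) ξ ∧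
      Matrix.det (Matrix.of fun i j : Fin d =>
          iteratedFDeriv ℝ 2 (fun x : EuclideanSpace ℝ (Fin d) => φ ‖x‖) ξ
            ![EuclideanSpace.single i 1, EuclideanSpace.single j 1]) =
        (deriv φ ‖ξ‖ / ‖ξ‖) ^ (d - 1) * deriv (deriv φ) ‖ξ‖ := by
  intro ξ hξ
  have hξ' : ‖ξ‖ ≠ 0 := norm_ne_zero_iff.mpr hξ
  have : Nonempty (Fin d) := ⟨⟨0, hd⟩⟩
  refine ⟨(hφ.contDiffAt (Ioi_mem_nhds (norm_pos_iff.mpr hξ))).comp ξ (contDiffAt_norm ℝ hξ), ?_⟩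
  have h_dot : (⇑ξ) ⬝ᵥ (⇑ξ) = ‖ξ‖ ^ 2 := by
    rw [EuclideanSpace.real_norm_sq_eq]
    simp only [dotProduct, sq]
  have h_det := Matrix.det_scalar_add_smul_vecMulVec_self (deriv φ ‖ξ‖ / ‖ξ‖)
    ((deriv (deriv φ) ‖ξ‖ - deriv φ ‖ξ‖ / ‖ξ‖) / ‖ξ‖ ^ 2) (⇑ξ)
  rw [h_dot, div_mul_cancel₀ _ (pow_ne_zero 2 hξ'), add_sub_cancel, Fintype.card_fin] at h_det
  rw [← h_det]
  congr 1
  ext i j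
  rw [Matrix.of_apply, iteratedFDeriv_two_comp_norm_apply hφ hξ]
  simp [Matrix.vecMulVec_apply, Matrix.diagonal_apply, EuclideanSpace.inner_single_right,
    eq_comm]
end

section
/- Let d ≥ 2 be an integer, κ > 0, φ_κ(r) = r·√(1 + κ²r²) and h_{κ,d}(r) = (φ_κ′(r)/r)^{d−1}·φ_κ″(r) for r > 0. Then there exists a constant C > 0 such that for all λ > 0 one has h_{κ,d}(λ) > 0 and h_{κ,d}(λ)^{−1/2} ≤ C·κ^{−d/2}·( κλ/√(1 + κ²λ²) )^{(d−2)/2}. -/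
theorem hasDerivAt_sqrt_one_add_sq (κ r : ℝ) :
    HasDerivAt (fun r : ℝ => Real.sqrt (1 + κ ^ 2 * r ^ 2))
      (κ ^ 2 * r / Real.sqrt (1 + κ ^ 2 * r ^ 2)) r := by
  have hpos : 0 < 1 + κ ^ 2 * r ^ 2 := by positivity
  have h := (((hasDerivAt_pow 2 r).const_mul (κ ^ 2)).const_add 1).sqrt hpos.ne'
  convert h using 1
  have hs := (Real.sqrt_pos.2 hpos).ne'
  push_cast
  field_simp

theorem deriv_bogoliubovPhase (κ : ℝ) :
    deriv (bogoliubovPhase κ) =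
      fun r => (1 + 2 * (κ ^ 2 * r ^ 2)) / Real.sqrt (1 + κ ^ 2 * r ^ 2) := by
  funext r
  have hpos : 0 < 1 + κ ^ 2 * r ^ 2 := by positivity
  have hs := (Real.sqrt_pos.2 hpos).ne'
  have hsq := Real.sq_sqrt hpos.le
  refine ((hasDerivAt_id r).mul (hasDerivAt_sqrt_one_add_sq κ r)).deriv.trans ?_
  simp only [id]
  field_simp
  linear_combination hsq

theorem deriv_deriv_bogoliubovPhase (κ r : ℝ) :
    deriv (deriv (bogoliubovPhase κ)) r =
      κ ^ 2 * r * (3 + 2 * (κ ^ 2 * r ^ 2)) / Real.sqrt (1 + κ ^ 2 * r ^ 2) ^ 3 := by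
  have hpos : 0 < 1 + κ ^ 2 * r ^ 2 := by positivity
  have hs := (Real.sqrt_pos.2 hpos).ne'
  have hsq := Real.sq_sqrt hpos.le
  rw [deriv_bogoliubovPhase]
  have hnum : HasDerivAt (fun r : ℝ => 1 + 2 * (κ ^ 2 * r ^ 2)) (4 * κ ^ 2 * r) r := by
    refine ((((hasDerivAt_pow 2 r).const_mul (κ ^ 2)).const_mul 2).const_add 1).congr_deriv ?_
    push_cast
    ring
  refine (hnum.div (hasDerivAt_sqrt_one_add_sq κ r) hs).deriv.trans ?_
  field_simp
  linear_combination 4 * κ ^ 2 * r * hsq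

/-- The angular eigenvalue `φ_κ′(r)/r` of the Hessian is bounded below by `√(1 + κ²r²)/r`. -/
theorem sqrt_div_le_deriv_bogoliubovPhase_div (κ : ℝ) {r : ℝ} (hr : 0 < r) :
    Real.sqrt (1 + κ ^ 2 * r ^ 2) / r ≤ deriv (bogoliubovPhase κ) r / r := by
  have hpos : 0 < 1 + κ ^ 2 * r ^ 2 := by positivity
  have hs := Real.sqrt_pos.2 hpos
  have hsq := Real.sq_sqrt hpos.le
  rw [deriv_bogoliubovPhase]
  gcongr
  rw [le_div_iff₀ hs]
  nlinarith [sq_nonneg (κ * r)]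

/-- The radial eigenvalue `φ_κ″(r)` of the Hessian is bounded below by `κ²r/√(1 + κ²r²)`. -/
theorem div_sqrt_le_deriv_deriv_bogoliubovPhase (κ : ℝ) {r : ℝ} (hr : 0 < r) :
    κ ^ 2 * r / Real.sqrt (1 + κ ^ 2 * r ^ 2) ≤ deriv (deriv (bogoliubovPhase κ)) r := by
  have hpos : 0 < 1 + κ ^ 2 * r ^ 2 := by positivity
  have hs := Real.sqrt_pos.2 hpos
  have hsq := Real.sq_sqrt hpos.le
  rw [deriv_deriv_bogoliubovPhase, div_le_div_iff₀ hs (by positivity), pow_succ √_ 2, hsq,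
    ← mul_assoc]
  refine mul_le_mul_of_nonneg_right (mul_le_mul_of_nonneg_left ?_ (by positivity)) hs.le
  nlinarith [sq_nonneg (κ * r)]

theorem mul_pow_rpow_neg_half {κ a : ℝ} (hκ : 0 < κ) (ha : 0 < a) (n : ℕ) :
    (κ ^ 2 * a ^ n) ^ (-(1 : ℝ) / 2) =
      κ ^ (-((n : ℝ) + 2) / 2) * (κ / a) ^ ((n : ℝ) / 2) := by
  rw [← Real.rpow_natCast κ 2, ← Real.rpow_natCast a n,
    Real.mul_rpow (by positivity) (by positivity), ← Real.rpow_mul hκ.le, ← Real.rpow_mul ha.le,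
    Real.div_rpow hκ.le ha.le, div_eq_mul_inv (_ ^ _) (a ^ _), ← Real.rpow_neg ha.le,
    ← mul_assoc, ← Real.rpow_add hκ]
  congr 2
  · push_cast
    ring
  · ring

/-- For `d ≥ 2` there is `C > 0` such that for all `λ > 0` the Hessian determinant
`h_{κ,d}(λ) = (φ_κ′(λ)/λ)^{d−1}·φ_κ″(λ)` is positive and
`h_{κ,d}(λ)^{−1/2} ≤ C·κ^{−d/2}·(κλ/√(1+κ²λ²))^{(d−2)/2}`. -/
theorem stmt_13 (d : ℕ) (hd : 2 ≤ d) (κ : ℝ) (hκ : 0 < κ) :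
    ∃ C : ℝ, 0 < C ∧ ∀ l : ℝ, 0 < l →
      0 < (deriv (bogoliubovPhase κ) l / l) ^ (d - 1) *
          deriv (deriv (bogoliubovPhase κ)) l ∧
      ((deriv (bogoliubovPhase κ) l / l) ^ (d - 1) *
          deriv (deriv (bogoliubovPhase κ)) l) ^ (-(1 : ℝ) / 2) ≤
        C * κ ^ (-(d : ℝ) / 2) *
          (κ * l / Real.sqrt (1 + κ ^ 2 * l ^ 2)) ^ (((d : ℝ) - 2) / 2) := by
  obtain ⟨n, rfl⟩ := Nat.exists_eq_add_of_le' hd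
  refine ⟨1, one_pos, fun l hl => ?_⟩
  have hs : 0 < Real.sqrt (1 + κ ^ 2 * l ^ 2) := Real.sqrt_pos.2 (by positivity)
  have h1 := sqrt_div_le_deriv_bogoliubovPhase_div κ hl
  have h2 := div_sqrt_le_deriv_deriv_bogoliubovPhase κ hl
  set s := Real.sqrt (1 + κ ^ 2 * l ^ 2)
  have ha : 0 < s / l := by positivity
  have hlow : κ ^ 2 * (s / l) ^ n ≤ (deriv (bogoliubovPhase κ) l / l) ^ (n + 2 - 1) *
      deriv (deriv (bogoliubovPhase κ)) l := by
    calc κ ^ 2 * (s / l) ^ n = (s / l) ^ (n + 1) * (κ ^ 2 * l / s) := by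
          rw [pow_succ (s / l), mul_assoc, show s / l * (κ ^ 2 * l / s) = κ ^ 2 by field_simp,
            mul_comm]
      _ ≤ _ := by
          rw [show n + 2 - 1 = n + 1 from rfl]
          exact mul_le_mul (pow_le_pow_left₀ ha.le h1 _) h2 (by positivity)
            (pow_nonneg (ha.le.trans h1) _)
  have hpos : 0 < κ ^ 2 * (s / l) ^ n := by positivity
  refine ⟨hpos.trans_le hlow, ?_⟩
  refine (Real.rpow_le_rpow_of_nonpos hpos hlow (by norm_num)).trans_eq ?_
  rw [mul_pow_rpow_neg_half hκ ha, one_mul, div_div_eq_mul_div]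
  push_cast
  rw [add_sub_cancel_right]
end

section
/- Let d ≥ 2 be an integer, κ > 0, ε > 0, R > 0, let 2 ≤ q ≤ ∞ with conjugate exponent q′, and let δ be a real with 0 ≤ δ ≤ (d − 2)/2. Let f : ℝ^d → ℂ be a Schwartz function whose Fourier transform f̂ is supported in the annulus { ξ : R/2 ≤ ‖ξ‖ ≤ 2R }, and for t > 0 let (e^{itH_ε}f)(x) denote the inverse Fourier transform of ξ ↦ exp( i·t·ω_{ε,κ}(ξ) )·f̂(ξ), where ω_{ε,κ}(ξ) = (1/ε)·‖ξ‖·√(1 + ε²κ²‖ξ‖²). Then there exists a constant C > 0, depending only on d, κ, q and δ (and not on ε, R, t or f), such that ‖e^{itH_ε}f‖_{L^q(ℝ^d)} ≤ C·t^{−d(1/2 − 1/q)}·(εR)^{δ(1 − 2/q)}·‖f‖_{L^{q′}(ℝ^d)}. -/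
open FourierTransform MeasureTheory ENNReal

/-- Second-derivative van der Corput estimate with an amplitude vanishing at the endpoints. -/
lemma norm_integral_exp_le_of_second_deriv {a b l M M' : ℝ} (hab : a ≤ b) (hl : 0 < l)
    {φ φ' φ'' : ℝ → ℝ} {g g' : ℝ → ℂ}
    (hφ : ∀ x ∈ Set.Icc a b, HasDerivAt φ (φ' x) x)
    (hφ' : ∀ x ∈ Set.Icc a b, HasDerivAt φ' (φ'' x) x)
    (hφc : ContinuousOn φ'' (Set.Icc a b))
    (hφl : ∀ x ∈ Set.Icc a b, l ≤ φ'' x)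
    (hg : ∀ x ∈ Set.Icc a b, HasDerivAt g (g' x) x)
    (hgc : ContinuousOn g' (Set.Icc a b))
    (hga : g a = 0) (hgb : g b = 0)
    (hM : ∀ x ∈ Set.Icc a b, ‖g x‖ ≤ M) (hM' : ∀ x ∈ Set.Icc a b, ‖g' x‖ ≤ M') :
    ‖∫ x in a..b, g x * Complex.exp (Complex.I * φ x)‖ ≤
      (2 * Real.pi * M + (b - a) * M') / √l := by
  have hs : 0 < √l := Real.sqrt_pos.2 hl
  have hss : √l * √l = l := Real.mul_self_sqrt hl.le
  have hIcc : Set.uIcc a b = Set.Icc a b := Set.uIcc_of_le hab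
  have hM0 : 0 ≤ M := (norm_nonneg _).trans (hM a ⟨le_rfl, hab⟩)
  have hD : ∀ u : ℝ, 0 < u ^ 2 + l := fun u => by positivity
  have cφ : ContinuousOn φ (Set.Icc a b) := fun x hx => (hφ x hx).continuousAt.continuousWithinAt
  have cφ' : ContinuousOn φ' (Set.Icc a b) :=
    fun x hx => (hφ' x hx).continuousAt.continuousWithinAt
  have cg : ContinuousOn g (Set.Icc a b) := fun x hx => (hg x hx).continuousAt.continuousWithinAt
  set e : ℝ → ℂ := fun x => Complex.exp (Complex.I * φ x) with he
  have ce : ContinuousOn e (Set.Icc a b) := by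
    apply Complex.continuous_exp.comp_continuousOn
    exact continuousOn_const.mul (Complex.continuous_ofReal.comp_continuousOn cφ)
  have ne : ∀ x, ‖e x‖ = 1 := fun x => by
    simp only [he]; rw [mul_comm]; exact Complex.norm_exp_ofReal_mul_I _
  set h : ℝ → ℝ := fun x => φ' x / (φ' x ^ 2 + l) with hh
  set h' : ℝ → ℝ := fun x => (l - φ' x ^ 2) / (φ' x ^ 2 + l) ^ 2 * φ'' x with hh'
  have ch : ContinuousOn h (Set.Icc a b) :=
    cφ'.div ((cφ'.pow 2).add continuousOn_const) (fun x _ => (hD _).ne')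
  have ch' : ContinuousOn h' (Set.Icc a b) :=
    ((continuousOn_const.sub (cφ'.pow 2)).div (((cφ'.pow 2).add continuousOn_const).pow 2)
      (fun x _ => pow_ne_zero _ (hD _).ne')).mul hφc
  have dh : ∀ x ∈ Set.Icc a b, HasDerivAt h (h' x) x := by
    intro x hx
    have := (hφ' x hx).div (((hφ' x hx).pow 2).add_const l) (hD _).ne'
    refine HasDerivAt.congr_deriv (f := h) this ?_
    simp only [hh', Pi.pow_apply]; field_simp; push_cast; ring
  have de : ∀ x ∈ Set.Icc a b, HasDerivAt e (e x * (Complex.I * φ' x)) x := by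
    intro x hx
    exact (((hφ x hx).ofReal_comp).const_mul Complex.I).cexp
  set w : ℝ → ℝ := fun x => φ'' x / (φ' x ^ 2 + l) with hw
  have cw : ContinuousOn w (Set.Icc a b) :=
    hφc.div ((cφ'.pow 2).add continuousOn_const) (fun x _ => (hD _).ne')
  have dA : ∀ x ∈ Set.Icc a b, HasDerivAt (fun x => Real.arctan (φ' x / √l) / √l) (w x) x := by
    intro x hx
    have := (((hφ' x hx).div_const (√l)).arctan).div_const (√l)
    refine this.congr_deriv ?_
    simp only [hw]
    rw [div_pow, Real.sq_sqrt hl.le]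
    have := (hD (φ' x)).ne'
    have h2 : 1 + φ' x ^ 2 / l ≠ 0 := by
      have : 0 ≤ φ' x ^ 2 / l := by positivity
      positivity
    field_simp
    rw [Real.sq_sqrt hl.le]; field_simp; ring
  have Iw : ∫ x in a..b, w x ≤ Real.pi / √l := by
    rw [intervalIntegral.integral_eq_sub_of_hasDerivAt (fun x hx => dA x (hIcc ▸ hx))
      (ContinuousOn.intervalIntegrable (hIcc ▸ cw)), ← sub_div]
    gcongr
    have h1 := Real.arctan_lt_pi_div_two (φ' b / √l)
    have h2 := Real.neg_pi_div_two_lt_arctan (φ' a / √l)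
    linarith
  set F' : ℝ → ℂ := fun x => g' x * (e x * h x) +
    g x * (e x * (Complex.I * φ' x) * h x + e x * h' x) with hF'
  have dF : ∀ x ∈ Set.Icc a b, HasDerivAt (fun x => g x * (e x * h x)) (F' x) x := by
    intro x hx
    exact (hg x hx).mul ((de x hx).mul ((dh x hx).ofReal_comp))
  have coR : ∀ {k : ℝ → ℝ}, ContinuousOn k (Set.Icc a b) →
      ContinuousOn (fun x => (k x : ℂ)) (Set.Icc a b) :=
    fun hk => Complex.continuous_ofReal.comp_continuousOn hk
  have cF' : ContinuousOn F' (Set.Icc a b) :=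
    (hgc.mul (ce.mul (coR ch))).add (cg.mul (((ce.mul (continuousOn_const.mul (coR cφ'))).mul
      (coR ch)).add (ce.mul (coR ch'))))
  have IF : ∫ x in a..b, F' x = 0 := by
    rw [intervalIntegral.integral_eq_sub_of_hasDerivAt (fun x hx => dF x (hIcc ▸ hx))
      (ContinuousOn.intervalIntegrable (hIcc ▸ cF'))]
    simp [hga, hgb]
  have habs : ∀ x, |h x| ≤ 1 / √l := by
    intro x
    simp only [hh]
    rw [abs_div, abs_of_pos (hD _), div_le_div_iff₀ (hD _) hs]
    nlinarith [sq_nonneg (|φ' x| - √l), sq_abs (φ' x), abs_nonneg (φ' x), hss]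
  have key : ∫ x in a..b, g x * e x =
      ∫ x in a..b, (g x * e x - (-Complex.I) * F' x) := by
    rw [intervalIntegral.integral_sub, intervalIntegral.integral_const_mul, IF]
    · simp
    · exact ContinuousOn.intervalIntegrable (hIcc ▸ cg.mul ce)
    · exact ContinuousOn.intervalIntegrable (hIcc ▸ continuousOn_const.mul cF')
  have bound : ∀ x ∈ Set.Icc a b, ‖g x * e x - (-Complex.I) * F' x‖ ≤
      2 * M * w x + M' / √l := by
    intro x hx
    have hp := hφl x hx
    have e1 : g x * e x - (-Complex.I) * F' x =
        g x * e x * ((1 - φ' x * h x : ℝ) : ℂ) + Complex.I * (g x * e x * h' x) +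
          Complex.I * (g' x * e x * h x) := by
      simp only [hF']; push_cast
      linear_combination (-(g x * e x * φ' x * h x) : ℂ) * Complex.I_sq * (-1)
    have b1 : |1 - φ' x * h x| ≤ w x := by
      have : 1 - φ' x * h x = l / (φ' x ^ 2 + l) := by
        simp only [hh]; have := (hD (φ' x)).ne'; field_simp; ring
      rw [this, abs_of_pos (div_pos hl (hD _))]
      exact div_le_div_of_nonneg_right hp (hD _).le
    have b2 : |h' x| ≤ w x := by
      simp only [hh', hw]
      rw [abs_mul, abs_div, abs_of_pos (lt_of_lt_of_le hl hp), abs_of_pos (pow_pos (hD _) 2),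
        div_mul_eq_mul_div, div_le_div_iff₀ (pow_pos (hD _) 2) (hD _)]
      have : |l - φ' x ^ 2| ≤ φ' x ^ 2 + l := abs_le.2 ⟨by nlinarith [sq_nonneg (φ' x)],
        by nlinarith [sq_nonneg (φ' x)]⟩
      calc |l - φ' x ^ 2| * φ'' x * (φ' x ^ 2 + l)
          ≤ (φ' x ^ 2 + l) * φ'' x * (φ' x ^ 2 + l) := by
            have := hD (φ' x); have : 0 ≤ φ'' x := by linarith
            gcongr
        _ = _ := by ring
    have w0 : 0 ≤ w x := (abs_nonneg _).trans b2
    rw [e1]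
    calc _ ≤ ‖g x * e x * ((1 - φ' x * h x : ℝ) : ℂ)‖ + ‖Complex.I * (g x * e x * h' x)‖ +
          ‖Complex.I * (g' x * e x * h x)‖ := norm_add₃_le
      _ = ‖g x‖ * |1 - φ' x * h x| + ‖g x‖ * |h' x| + ‖g' x‖ * |h x| := by
          simp only [norm_mul, ne, Complex.norm_I, Complex.norm_real, Real.norm_eq_abs]; ring
      _ ≤ M * w x + M * w x + M' * (1 / √l) := by
          have := hM x hx; have := hM' x hx; have := habs x
          have : 0 ≤ M' := (norm_nonneg _).trans (hM' x hx)
          gcongr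
      _ = _ := by ring
  rw [key]
  calc _ ≤ ∫ x in a..b, (2 * M * w x + M' / √l) := by
        refine intervalIntegral.norm_integral_le_of_norm_le hab ?_ ?_
        · exact Filter.Eventually.of_forall fun x hx => bound x ⟨hx.1.le, hx.2⟩
        · exact ContinuousOn.intervalIntegrable
            (hIcc ▸ (continuousOn_const.mul cw).add continuousOn_const)
    _ = 2 * M * (∫ x in a..b, w x) + (b - a) * (M' / √l) := by
        rw [intervalIntegral.integral_add, intervalIntegral.integral_const_mul,
          intervalIntegral.integral_const, smul_eq_mul]
        · exact ContinuousOn.intervalIntegrable (hIcc ▸ (continuousOn_const.mul cw))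
        · exact intervalIntegrable_const
    _ ≤ 2 * M * (Real.pi / √l) + (b - a) * (M' / √l) := by gcongr
    _ = _ := by ring

/-- `∫₀^π w(θ) e^{is cos θ} dθ`, an unnormalized Bessel-type integral with weight `w`. -/
noncomputable def cosIntegral (w : ℝ → ℝ) (s : ℝ) : ℂ :=
  ∫ θ in (0 : ℝ)..Real.pi, (w θ : ℂ) * Complex.exp (Complex.I * (s * Real.cos θ : ℝ))

lemma hasDerivAt_cosIntegral {w : ℝ → ℝ} (hw : Continuous w) (s : ℝ) :
    HasDerivAt (cosIntegral w) (Complex.I * cosIntegral (fun θ => w θ * Real.cos θ) s) s := by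
  have hpi := Real.pi_pos.le
  have hd : ∀ θ x : ℝ, HasDerivAt
      (fun s : ℝ => (w θ : ℂ) * Complex.exp (Complex.I * (s * Real.cos θ : ℝ)))
      ((w θ : ℂ) * (Complex.exp (Complex.I * (x * Real.cos θ : ℝ)) *
        (Complex.I * (Real.cos θ : ℝ)))) x := by
    intro θ x
    have h1 : HasDerivAt (fun s : ℝ => s * Real.cos θ) (Real.cos θ) x := by
      simpa using (hasDerivAt_id x).mul_const (Real.cos θ)
    exact ((h1.ofReal_comp.const_mul Complex.I).cexp).const_mul _
  have hc : Continuous (Function.uncurry fun s θ : ℝ => (w θ : ℂ) *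
      Complex.exp (Complex.I * (s * Real.cos θ : ℝ))) := by
    simp only [Function.uncurry_def]; fun_prop
  have hc' : Continuous (Function.uncurry fun s θ : ℝ => (w θ : ℂ) *
      (Complex.exp (Complex.I * (s * Real.cos θ : ℝ)) * (Complex.I * (Real.cos θ : ℝ)))) := by
    simp only [Function.uncurry_def]; fun_prop
  have := (intervalIntegral.hasDerivAt_integral_of_dominated_loc_of_deriv_le
    (μ := volume) (a := 0) (b := Real.pi) (s := Set.univ) (x₀ := s) (bound := fun θ => |w θ|)
    (F := fun s θ => (w θ : ℂ) * Complex.exp (Complex.I * (s * Real.cos θ : ℝ)))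
    (F' := fun s θ => (w θ : ℂ) *
      (Complex.exp (Complex.I * (s * Real.cos θ : ℝ)) * (Complex.I * (Real.cos θ : ℝ))))
    Filter.univ_mem ?_ ?_ ?_ ?_ ?_ ?_).2
  · refine HasDerivAt.congr_deriv (f := cosIntegral w) this ?_
    rw [cosIntegral, ← intervalIntegral.integral_const_mul]
    congr 1; ext θ; push_cast; ring
  · exact Filter.Eventually.of_forall fun x =>
      (hc.comp (Continuous.prodMk_right x)).aestronglyMeasurable
  · exact (hc.comp (Continuous.prodMk_right s)).intervalIntegrable _ _
  · exact (hc'.comp (Continuous.prodMk_right s)).aestronglyMeasurable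
  · refine Filter.Eventually.of_forall fun θ _ x _ => ?_
    rw [norm_mul, norm_mul, norm_mul, mul_comm Complex.I, Complex.norm_exp_ofReal_mul_I,
      Complex.norm_I, Complex.norm_real, Complex.norm_real, Real.norm_eq_abs, Real.norm_eq_abs]
    have := Real.abs_cos_le_one θ
    have := abs_nonneg (w θ)
    nlinarith
  · exact hw.abs.intervalIntegrable _ _
  · exact Filter.Eventually.of_forall fun θ _ x _ => hd θ x

lemma continuous_cosIntegral {w : ℝ → ℝ} (hw : Continuous w) : Continuous (cosIntegral w) :=
  continuous_iff_continuousAt.2 fun s => (hasDerivAt_cosIntegral hw s).continuousAt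

lemma norm_cosIntegral_sin_pow_le (n : ℕ) (s : ℝ) :
    ‖cosIntegral (fun θ => Real.sin θ ^ n) s‖ ≤ Real.pi := by
  have := intervalIntegral.norm_integral_le_of_norm_le_const (a := 0) (b := Real.pi) (C := 1)
    (f := fun θ => ((Real.sin θ ^ n : ℝ) : ℂ) * Complex.exp (Complex.I * (s * Real.cos θ : ℝ)))
    (fun θ _ => by
      rw [norm_mul, mul_comm Complex.I, Complex.norm_exp_ofReal_mul_I, Complex.norm_real,
        norm_pow, mul_one]
      exact pow_le_one₀ (norm_nonneg _) (Real.abs_sin_le_one θ))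
  simpa [cosIntegral, abs_of_pos Real.pi_pos] using this

/-- The Bessel differential equation for `s ↦ ∫₀^π sinⁿ(θ) e^{is cos θ} dθ`. -/
lemma cosIntegral_sin_pow_ode (n : ℕ) (s : ℝ) :
    (s : ℂ) * (cosIntegral (fun θ => Real.sin θ ^ n) s -
      cosIntegral (fun θ => Real.sin θ ^ n * Real.cos θ * Real.cos θ) s) +
      (n + 1) * (Complex.I * cosIntegral (fun θ => Real.sin θ ^ n * Real.cos θ) s) = 0 := by
  have hd : ∀ θ : ℝ, HasDerivAt
      (fun θ : ℝ => ((Real.sin θ ^ (n + 1) : ℝ) : ℂ) *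
        Complex.exp (Complex.I * (s * Real.cos θ : ℝ)))
      ((((n + 1 : ℕ) * Real.sin θ ^ n * Real.cos θ : ℝ) : ℂ) *
          Complex.exp (Complex.I * (s * Real.cos θ : ℝ)) +
        ((Real.sin θ ^ (n + 1) : ℝ) : ℂ) * (Complex.exp (Complex.I * (s * Real.cos θ : ℝ)) *
        (Complex.I * (s * -Real.sin θ : ℝ)))) θ := by
    intro θ
    have h1 := ((Real.hasDerivAt_sin θ).pow (n + 1)).ofReal_comp
    have h2 := ((((Real.hasDerivAt_cos θ).const_mul s).ofReal_comp).const_mul Complex.I).cexp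
    exact h1.mul h2
  have h0 := intervalIntegral.integral_eq_sub_of_hasDerivAt (a := 0) (b := Real.pi)
    (fun θ _ => hd θ) (Continuous.intervalIntegrable (by fun_prop) _ _)
  simp only [Real.sin_pi, Real.sin_zero, ne_eq, Nat.succ_ne_zero, not_false_eq_true, zero_pow,
    Complex.ofReal_zero, zero_mul, sub_zero] at h0
  have i1 : ∀ k : ℝ → ℝ, Continuous k → IntervalIntegrable
      (fun θ => (k θ : ℂ) * Complex.exp (Complex.I * (s * Real.cos θ : ℝ))) volume 0 Real.pi :=
    fun k hk => Continuous.intervalIntegrable (by fun_prop) _ _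
  rw [← mul_zero Complex.I, ← h0, cosIntegral, cosIntegral, cosIntegral,
    ← intervalIntegral.integral_sub (i1 _ (by fun_prop)) (i1 _ (by fun_prop)),
    ← intervalIntegral.integral_const_mul, ← intervalIntegral.integral_const_mul,
    ← intervalIntegral.integral_const_mul, ← intervalIntegral.integral_const_mul,
    ← intervalIntegral.integral_add]
  · congr 1; ext θ
    have : Complex.cos θ * Complex.cos θ = 1 - Complex.sin θ * Complex.sin θ := by
      linear_combination Complex.sin_sq_add_cos_sq (θ : ℂ)
    push_cast
    linear_combination (-(s : ℂ) * Complex.sin θ ^ n *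
      Complex.exp (Complex.I * (s * Complex.cos θ))) * this +
      (s * Complex.sin θ ^ (n + 2) * Complex.exp (Complex.I * (s * Complex.cos θ))) *
        Complex.I_sq
  · exact Continuous.intervalIntegrable (by fun_prop) _ _
  · exact Continuous.intervalIntegrable (by fun_prop) _ _

/-- Solutions of `v'' = (c / s² - 1) v` are bounded, together with `v'`, away from `0`. -/
lemma exists_bound_of_ode {c s₀ : ℝ} (hs₀ : 0 < s₀) {v v' : ℝ → ℂ}
    (hv : ∀ s ∈ Set.Ici s₀, HasDerivAt v (v' s) s)
    (hv' : ∀ s ∈ Set.Ici s₀, HasDerivAt v' ((c / s ^ 2 - 1 : ℝ) * v s) s) :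
    ∃ C : ℝ, ∀ s ∈ Set.Ici s₀, ‖v s‖ ≤ C ∧ ‖v' s‖ ≤ C := by
  set E : ℝ → ℝ := fun s => (‖v s‖ ^ 2 + ‖v' s‖ ^ 2) * Real.exp (|c| / s) with hE
  have dE : ∀ s ∈ Set.Ici s₀, HasDerivAt E
      ((2 * inner ℝ (v s) (v' s) + 2 * inner ℝ (v' s) (((c / s ^ 2 - 1 : ℝ) : ℂ) * v s)) *
        Real.exp (|c| / s) + (‖v s‖ ^ 2 + ‖v' s‖ ^ 2) *
        (Real.exp (|c| / s) * (-|c| / s ^ 2))) s := by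
    intro s hs
    have hs' : s ≠ 0 := (lt_of_lt_of_le hs₀ hs).ne'
    have h3 : HasDerivAt (fun s => |c| / s) (-|c| / s ^ 2) s := by
      simpa [div_eq_mul_inv] using (hasDerivAt_inv hs').const_mul |c|
    exact (((hv s hs).norm_sq).add ((hv' s hs).norm_sq)).mul h3.exp
  have anti : AntitoneOn E (Set.Ici s₀) := by
    refine antitoneOn_of_deriv_nonpos (convex_Ici _)
      (fun s hs => (dE s hs).continuousAt.continuousWithinAt)
      (fun s hs => (dE s (interior_subset hs)).differentiableAt.differentiableWithinAt) ?_
    intro s hs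
    have hs := interior_subset hs
    have hs' : 0 < s := lt_of_lt_of_le hs₀ hs
    rw [(dE s hs).deriv]
    have e1 : inner ℝ (v' s) (((c / s ^ 2 - 1 : ℝ) : ℂ) * v s) =
        (c / s ^ 2 - 1) * inner ℝ (v s) (v' s) := by
      rw [← Complex.real_smul, inner_smul_right, real_inner_comm]
    rw [e1]
    have h1 : |inner ℝ (v s) (v' s)| ≤ ‖v s‖ * ‖v' s‖ := abs_real_inner_le_norm _ _
    have h2 : 2 * (c * inner ℝ (v s) (v' s)) ≤ |c| * (‖v s‖ ^ 2 + ‖v' s‖ ^ 2) := by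
      have : c * inner ℝ (v s) (v' s) ≤ |c| * (‖v s‖ * ‖v' s‖) :=
        (le_abs_self _).trans (by rw [abs_mul]; gcongr)
      nlinarith [sq_nonneg (‖v s‖ - ‖v' s‖), abs_nonneg c]
    have : (2 * inner ℝ (v s) (v' s) + 2 * ((c / s ^ 2 - 1) * inner ℝ (v s) (v' s))) *
        Real.exp (|c| / s) + (‖v s‖ ^ 2 + ‖v' s‖ ^ 2) *
        (Real.exp (|c| / s) * (-|c| / s ^ 2)) =
        (2 * (c * inner ℝ (v s) (v' s)) - |c| * (‖v s‖ ^ 2 + ‖v' s‖ ^ 2)) *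
          (Real.exp (|c| / s) / s ^ 2) := by field_simp; ring
    rw [this]
    exact mul_nonpos_of_nonpos_of_nonneg (by linarith) (by positivity)
  have hb : ∀ s ∈ Set.Ici s₀, ‖v s‖ ^ 2 + ‖v' s‖ ^ 2 ≤ E s₀ := by
    intro s hs
    have hs' : 0 < s := lt_of_lt_of_le hs₀ hs
    refine le_trans ?_ (anti Set.self_mem_Ici hs hs)
    have : 1 ≤ Real.exp (|c| / s) := Real.one_le_exp (by positivity)
    exact le_mul_of_one_le_right (by positivity) this
  refine ⟨√(E s₀), fun s hs => ⟨?_, ?_⟩⟩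
  · exact Real.le_sqrt_of_sq_le (by nlinarith [hb s hs, sq_nonneg ‖v' s‖])
  · exact Real.le_sqrt_of_sq_le (by nlinarith [hb s hs, sq_nonneg ‖v s‖])

/-- Decomposition of `∫₀^π sinⁿ(θ) e^{is cos θ} dθ` into two oscillating pieces with
slowly varying amplitudes. -/
lemma exists_cosIntegral_decomposition (n : ℕ) {s₀ : ℝ} (hs₀ : 0 < s₀) :
    ∃ C : ℝ, 0 ≤ C ∧ ∃ A A' B B' : ℝ → ℂ,
      (∀ s ∈ Set.Ici s₀, HasDerivAt A (A' s) s ∧ HasDerivAt B (B' s) s ∧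
        ‖A s‖ ≤ C ∧ ‖B s‖ ≤ C ∧ ‖A' s‖ ≤ C / s ^ 2 ∧ ‖B' s‖ ≤ C / s ^ 2 ∧
        cosIntegral (fun θ => Real.sin θ ^ n) s = (s ^ (-(((n : ℝ) + 1) / 2)) : ℝ) *
          (Complex.exp (Complex.I * s) * A s + Complex.exp (Complex.I * (-s : ℝ)) * B s)) ∧
      ContinuousOn A' (Set.Ici s₀) ∧ ContinuousOn B' (Set.Ici s₀) := by
  set α : ℝ := ((n : ℝ) + 1) / 2 with hα
  set j : ℝ → ℂ := cosIntegral (fun θ => Real.sin θ ^ n) with hj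
  set j1 : ℝ → ℂ := cosIntegral (fun θ => Real.sin θ ^ n * Real.cos θ) with hj1
  set j2 : ℝ → ℂ := cosIntegral (fun θ => Real.sin θ ^ n * Real.cos θ * Real.cos θ) with hj2
  have dj : ∀ s, HasDerivAt j (Complex.I * j1 s) s := fun s =>
    hasDerivAt_cosIntegral (by fun_prop) s
  have dj1 : ∀ s, HasDerivAt j1 (Complex.I * j2 s) s := fun s =>
    hasDerivAt_cosIntegral (by fun_prop) s
  have hode : ∀ s : ℝ, (s : ℂ) * (j s - j2 s) + (n + 1) * (Complex.I * j1 s) = 0 :=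
    cosIntegral_sin_pow_ode n
  have dp : ∀ s ∈ Set.Ici s₀, ∀ β : ℝ,
      HasDerivAt (fun s : ℝ => ((s ^ β : ℝ) : ℂ)) ((β * s ^ (β - 1) : ℝ) : ℂ) s :=
    fun s hs β => (Real.hasDerivAt_rpow_const (Or.inl (lt_of_lt_of_le hs₀ hs).ne')).ofReal_comp
  set v : ℝ → ℂ := fun s => ((s ^ α : ℝ) : ℂ) * j s with hv
  set v' : ℝ → ℂ := fun s => (α : ℂ) * (((s ^ (α - 1) : ℝ) : ℂ) * j s) +
    ((s ^ α : ℝ) : ℂ) * (Complex.I * j1 s) with hv'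
  set c : ℝ := α * (α - 1) with hc
  have dv : ∀ s ∈ Set.Ici s₀, HasDerivAt v (v' s) s := by
    intro s hs
    refine ((dp s hs α).mul (dj s)).congr_deriv ?_
    simp only [hv']; push_cast; ring
  have dv' : ∀ s ∈ Set.Ici s₀, HasDerivAt v' ((c / s ^ 2 - 1 : ℝ) * v s) s := by
    intro s hs
    have hs' : 0 < s := lt_of_lt_of_le hs₀ hs
    refine ((((dp s hs (α - 1)).mul (dj s)).const_mul (α : ℂ)).add
      ((dp s hs α).mul ((dj1 s).const_mul Complex.I))).congr_deriv ?_
    have r1 : s ^ (α - 1) = s ^ α / s := by rw [Real.rpow_sub_one hs'.ne']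
    have r2 : s ^ (α - 1 - 1) = s ^ α / s ^ 2 := by
      rw [Real.rpow_sub_one hs'.ne', r1]; field_simp
    have hsc : (s : ℂ) ≠ 0 := by exact_mod_cast hs'.ne'
    have h := hode s
    have ha : (2 : ℂ) * α = n + 1 := by rw [hα]; push_cast; ring
    have h' : j2 s = j s + 2 * α * (Complex.I * j1 s) / s := by
      rw [ha]; field_simp; linear_combination -h
    simp only [hv, hc, r1, r2, h']
    push_cast
    field_simp
    ring_nf
    simp only [Complex.I_sq]
    ring_nf
    simp only [Complex.I_pow_three]
    ring
  obtain ⟨C, hC⟩ := exists_bound_of_ode hs₀ dv dv'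
  have hC0 : 0 ≤ C := (norm_nonneg _).trans (hC s₀ Set.self_mem_Ici).1
  have dexp : ∀ (σ : ℂ) (s : ℝ), HasDerivAt (fun s : ℝ => Complex.exp (σ * s))
      (Complex.exp (σ * s) * σ) s := by
    intro σ s
    simpa using (((hasDerivAt_id s).ofReal_comp).const_mul σ).cexp
  have nexp : ∀ s : ℝ, ‖Complex.exp (Complex.I * s)‖ = 1 := fun s => by
    rw [mul_comm]; exact Complex.norm_exp_ofReal_mul_I _
  have nexp' : ∀ s : ℝ, ‖Complex.exp (-Complex.I * s)‖ = 1 := fun s => by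
    have := Complex.norm_exp_ofReal_mul_I (-s)
    rw [← this]; congr 2; push_cast; ring
  have cont : ContinuousOn (fun s : ℝ => ((c / s ^ 2 : ℝ) : ℂ) * v s) (Set.Ici s₀) := by
    refine ContinuousOn.mul ?_ (fun s hs => (dv s hs).continuousAt.continuousWithinAt)
    refine Complex.continuous_ofReal.comp_continuousOn ?_
    exact continuousOn_const.div (continuousOn_id.pow 2)
      (fun s hs => pow_ne_zero 2 (lt_of_lt_of_le hs₀ hs).ne')
  have hcs : ∀ s : ℝ, ‖((c / s ^ 2 : ℝ) : ℂ)‖ = |c| / s ^ 2 := by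
    intro s
    rw [Complex.norm_real, Real.norm_eq_abs, abs_div, abs_of_nonneg (sq_nonneg s)]
  refine ⟨C + |c| * C, by positivity,
    fun s => (1 / 2) * (v s - Complex.I * v' s) * Complex.exp (-Complex.I * s),
    fun s => -(Complex.I / 2) * (((c / s ^ 2 : ℝ) : ℂ) * v s) * Complex.exp (-Complex.I * s),
    fun s => (1 / 2) * (v s + Complex.I * v' s) * Complex.exp (Complex.I * s),
    fun s => (Complex.I / 2) * (((c / s ^ 2 : ℝ) : ℂ) * v s) * Complex.exp (Complex.I * s),
    fun s hs => ⟨?_, ?_, ?_, ?_, ?_, ?_, ?_⟩, ?_, ?_⟩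
  · refine ((((dv s hs).sub ((dv' s hs).const_mul Complex.I)).const_mul (1 / 2 : ℂ)).mul
      (dexp (-Complex.I) s)).congr_deriv ?_
    simp only [Pi.sub_apply]
    push_cast
    linear_combination (1 / 2 * v' s * Complex.exp (-Complex.I * s)) * Complex.I_sq
  · refine ((((dv s hs).add ((dv' s hs).const_mul Complex.I)).const_mul (1 / 2 : ℂ)).mul
      (dexp Complex.I s)).congr_deriv ?_
    simp only [Pi.add_apply]
    push_cast
    linear_combination (1 / 2 * v' s * Complex.exp (Complex.I * s)) * Complex.I_sq
  · have := norm_sub_le (v s) (Complex.I * v' s)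
    rw [norm_mul, norm_mul, nexp', mul_one]
    rw [norm_mul Complex.I, Complex.norm_I, one_mul] at this
    have h2 : ‖(1 / 2 : ℂ)‖ = 1 / 2 := by norm_num
    rw [h2]
    have := hC s hs
    have : 0 ≤ |c| * C := by positivity
    linarith
  · have := norm_add_le (v s) (Complex.I * v' s)
    rw [norm_mul, norm_mul, nexp, mul_one]
    rw [norm_mul Complex.I, Complex.norm_I, one_mul] at this
    have h2 : ‖(1 / 2 : ℂ)‖ = 1 / 2 := by norm_num
    rw [h2]
    have := hC s hs
    have : 0 ≤ |c| * C := by positivity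
    linarith
  · rw [norm_mul, norm_mul, norm_mul, nexp', hcs, norm_neg, norm_div, Complex.norm_I, mul_one]
    have h1 := (hC s hs).1
    have h2 : ‖(2 : ℂ)‖ = 2 := by norm_num
    rw [h2]
    calc 1 / 2 * (|c| / s ^ 2 * ‖v s‖) ≤ 1 * (|c| / s ^ 2 * C) := by gcongr; norm_num
      _ = |c| * C / s ^ 2 := by ring
      _ ≤ _ := by gcongr; linarith
  · rw [norm_mul, norm_mul, norm_mul, nexp, hcs, norm_div, Complex.norm_I, mul_one]
    have h1 := (hC s hs).1
    have h2 : ‖(2 : ℂ)‖ = 2 := by norm_num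
    rw [h2]
    calc 1 / 2 * (|c| / s ^ 2 * ‖v s‖) ≤ 1 * (|c| / s ^ 2 * C) := by gcongr; norm_num
      _ = |c| * C / s ^ 2 := by ring
      _ ≤ _ := by gcongr; linarith
  · have hs' : 0 < s := lt_of_lt_of_le hs₀ hs
    have e1 : Complex.exp (-Complex.I * s) = (Complex.exp (Complex.I * s))⁻¹ := by
      rw [← Complex.exp_neg]; congr 1; ring
    have e2 : Complex.exp (Complex.I * (-s : ℝ)) = (Complex.exp (Complex.I * s))⁻¹ := by
      rw [← Complex.exp_neg]; congr 1; push_cast; ring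
    beta_reduce
    rw [e1, e2]
    have := Complex.exp_ne_zero (Complex.I * s)
    have hr : ((s ^ (-α) : ℝ) : ℂ) * ((s ^ α : ℝ) : ℂ) = 1 := by
      rw [← Complex.ofReal_mul, ← Real.rpow_add hs']; simp
    have : Complex.exp (Complex.I * s) * (1 / 2 * (v s - Complex.I * v' s) *
        (Complex.exp (Complex.I * s))⁻¹) + (Complex.exp (Complex.I * s))⁻¹ *
        (1 / 2 * (v s + Complex.I * v' s) * Complex.exp (Complex.I * s)) = v s := by
      field_simp; ring
    rw [this]
    simp only [hv]
    rw [← mul_assoc, hr, one_mul]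
  · exact (continuousOn_const.mul cont).mul (Continuous.continuousOn (by fun_prop))
  · exact (continuousOn_const.mul cont).mul (Continuous.continuousOn (by fun_prop))

lemma hasDerivAt_slice {P F : Type*} [NormedAddCommGroup P] [NormedSpace ℝ P]
    [NormedAddCommGroup F] [NormedSpace ℝ F] {f : P × ℝ → F} {p : P} {r : ℝ}
    (hf : DifferentiableAt ℝ f (p, r)) :
    HasDerivAt (fun r => f (p, r)) (fderiv ℝ f (p, r) (0, 1)) r := by
  have h1 : HasDerivAt (fun r : ℝ => (p, r)) ((0 : P), (1 : ℝ)) r :=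
    (hasDerivAt_const r p).prodMk (hasDerivAt_id r)
  exact hf.hasFDerivAt.comp_hasDerivAt r h1

lemma contDiffOn_fderiv_apply {P F : Type*} [NormedAddCommGroup P] [NormedSpace ℝ P]
    [NormedAddCommGroup F] [NormedSpace ℝ F] {f : P → F} {U : Set P} (hU : IsOpen U)
    (hf : ContDiffOn ℝ (⊤ : ℕ∞) f U) (e : P) :
    ContDiffOn ℝ (⊤ : ℕ∞) (fun z => fderiv ℝ f z e) U :=
  (hf.fderiv_of_isOpen hU (by simp)).clm_apply contDiffOn_const

/-- Non-stationary phase, uniformly for parameters in a compact set. -/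
lemma exists_bound_nonstationary_aux {P : Type*} [NormedAddCommGroup P] [NormedSpace ℝ P]
    {K : Set P} (hK : IsCompact K) {U : Set (P × ℝ)} (hU : IsOpen U) {α α' β' β : ℝ}
    (hα : α < α') (hαβ : α ≤ β) (hβ : β' < β) (hKU : K ×ˢ Set.Icc α β ⊆ U)
    {Ψ : P × ℝ → ℝ} (hΨ : ContDiffOn ℝ (⊤ : ℕ∞) Ψ U)
    (hΨ0 : ∀ z ∈ U, fderiv ℝ Ψ z (0, 1) ≠ 0) (N : ℕ) :
    ∀ a : P × ℝ → ℂ, ContDiffOn ℝ (⊤ : ℕ∞) a U →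
      (∀ z ∈ U, z.2 < α' ∨ β' < z.2 → a z = 0) →
      ∃ C : ℝ, ∀ p ∈ K, ∀ L : ℝ, 0 < L →
        ‖∫ r in α..β, a (p, r) * Complex.exp (Complex.I * (L * Ψ (p, r) : ℝ))‖ ≤ C / L ^ N := by
  have slice : ∀ {F : Type} [NormedAddCommGroup F] {f : P × ℝ → F}, ContinuousOn f U →
      ∀ p ∈ K, ContinuousOn (fun r => f (p, r)) (Set.Icc α β) := by
    intro F _ f hf p hp
    exact hf.comp (Continuous.continuousOn (by fun_prop)) (fun r hr => hKU ⟨hp, hr⟩)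
  have nexp : ∀ x : ℝ, ‖Complex.exp (Complex.I * x)‖ = 1 := fun s => by
    rw [mul_comm]; exact Complex.norm_exp_ofReal_mul_I _
  induction N with
  | zero =>
    intro a ha _
    obtain ⟨C, hC⟩ := (hK.prod isCompact_Icc).exists_bound_of_continuousOn
      (ha.continuousOn.mono hKU)
    refine ⟨C * |β - α|, fun p hp L _ => ?_⟩
    rw [pow_zero, div_one]
    refine intervalIntegral.norm_integral_le_of_norm_le_const fun r hr => ?_
    rw [norm_mul, nexp, mul_one]
    rw [Set.uIoc_of_le hαβ] at hr
    exact hC (p, r) ⟨hp, hr.1.le, hr.2⟩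
  | succ N ih =>
    intro a ha ha0
    have hΨ' := contDiffOn_fderiv_apply hU hΨ (0, 1)
    set D : P × ℝ → ℝ := fun z => fderiv ℝ Ψ z (0, 1) with hD
    set b : P × ℝ → ℂ := fun z => a z * ((D z)⁻¹ : ℝ) with hb
    have cb : ContDiffOn ℝ (⊤ : ℕ∞) b U :=
      ha.mul (Complex.ofRealCLM.contDiff.comp_contDiffOn (hΨ'.inv hΨ0))
    have hb0 : ∀ z ∈ U, z.2 < α' ∨ β' < z.2 → b z = 0 := by
      intro z hz h; simp [hb, ha0 z hz h]
    have cb' := contDiffOn_fderiv_apply hU cb (0, 1)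
    obtain ⟨C, hC⟩ := ih (fun z => fderiv ℝ b z (0, 1)) cb' (by
      intro z hz h
      have ho : IsOpen {z : P × ℝ | z.2 < α' ∨ β' < z.2} :=
        (isOpen_lt continuous_snd continuous_const).union
          (isOpen_lt continuous_const continuous_snd)
      have : b =ᶠ[nhds z] fun _ => 0 := by
        filter_upwards [hU.mem_nhds hz, ho.mem_nhds h] with y hy hy'
        exact hb0 y hy hy'
      rw [this.fderiv_eq]; simp)
    refine ⟨C, fun p hp L hL => ?_⟩
    have hIcc : Set.uIcc α β = Set.Icc α β := Set.uIcc_of_le hαβ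
    have mem : ∀ r ∈ Set.uIcc α β, (p, r) ∈ U := fun r hr => hKU ⟨hp, hIcc ▸ hr⟩
    have db : ∀ r ∈ Set.uIcc α β,
        HasDerivAt (fun r => b (p, r)) (fderiv ℝ b (p, r) (0, 1)) r := fun r hr =>
      hasDerivAt_slice ((cb.contDiffAt (hU.mem_nhds (mem r hr))).differentiableAt (by simp))
    have de : ∀ r ∈ Set.uIcc α β,
        HasDerivAt (fun r => Complex.exp (Complex.I * (L * Ψ (p, r) : ℝ)))
          (Complex.exp (Complex.I * (L * Ψ (p, r) : ℝ)) * (Complex.I * (L * D (p, r) : ℝ))) r :=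
      fun r hr => ((((hasDerivAt_slice ((hΨ.contDiffAt (hU.mem_nhds (mem r hr))).differentiableAt
        (by simp))).const_mul L).ofReal_comp).const_mul Complex.I).cexp
    have cΨ := slice hΨ.continuousOn p hp
    have cD := slice hΨ'.continuousOn p hp
    have ce : ContinuousOn (fun r => Complex.exp (Complex.I * (L * Ψ (p, r) : ℝ)))
        (Set.Icc α β) := fun r hr => (de r (hIcc ▸ hr)).continuousAt.continuousWithinAt
    have parts := intervalIntegral.integral_mul_deriv_eq_deriv_mul db de
      (ContinuousOn.intervalIntegrable (hIcc ▸ slice cb'.continuousOn p hp))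
      (ContinuousOn.intervalIntegrable (hIcc ▸ ce.mul (continuousOn_const.mul
        (Complex.continuous_ofReal.comp_continuousOn (continuousOn_const.mul cD)))))
    rw [hb0 (p, α) (mem α Set.left_mem_uIcc) (Or.inl hα),
      hb0 (p, β) (mem β Set.right_mem_uIcc) (Or.inr hβ)] at parts
    have hrew : ∫ r in α..β, b (p, r) * (Complex.exp (Complex.I * (L * Ψ (p, r) : ℝ)) *
        (Complex.I * (L * D (p, r) : ℝ))) = (Complex.I * L) * ∫ r in α..β, a (p, r) *
        Complex.exp (Complex.I * (L * Ψ (p, r) : ℝ)) := by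
      rw [← intervalIntegral.integral_const_mul]
      refine intervalIntegral.integral_congr fun r hr => ?_
      have : (D (p, r) : ℂ) ≠ 0 := by exact_mod_cast hΨ0 _ (mem r hr)
      simp only [hb]; push_cast; field_simp
    rw [hrew] at parts
    have hn := congrArg norm parts
    rw [norm_mul, norm_mul, Complex.norm_I, one_mul, Complex.norm_real, Real.norm_eq_abs,
      abs_of_pos hL] at hn
    have hle := hC p hp L hL
    simp only [zero_mul, sub_zero, zero_sub, norm_neg] at hn
    rw [pow_succ, ← div_div, le_div_iff₀ hL, mul_comm, hn]
    exact hle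

lemma exists_bound_nonstationary {P : Type*} [NormedAddCommGroup P] [NormedSpace ℝ P]
    {K : Set P} (hK : IsCompact K) {V : Set (P × ℝ)} (hV : IsOpen V) {α α' β' β : ℝ}
    (hα : α < α') (hαβ : α ≤ β) (hβ : β' < β) (hKV : K ×ˢ Set.Icc α β ⊆ V)
    {Ψ : P × ℝ → ℝ} (hΨ : ContDiffOn ℝ (⊤ : ℕ∞) Ψ V)
    (hΨ0 : ∀ z ∈ K ×ˢ Set.Icc α β, fderiv ℝ Ψ z (0, 1) ≠ 0) (N : ℕ)
    {a : P × ℝ → ℂ} (ha : ContDiff ℝ (⊤ : ℕ∞) a)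
    (ha0 : ∀ z, z.2 < α' ∨ β' < z.2 → a z = 0) :
    ∃ C : ℝ, ∀ p ∈ K, ∀ L : ℝ, 0 < L →
      ‖∫ r in α..β, a (p, r) * Complex.exp (Complex.I * (L * Ψ (p, r) : ℝ))‖ ≤ C / L ^ N := by
  have hU : IsOpen (V ∩ (fun z => fderiv ℝ Ψ z (0, 1)) ⁻¹' {0}ᶜ) :=
    (contDiffOn_fderiv_apply hV hΨ (0, 1)).continuousOn.isOpen_inter_preimage hV
      isOpen_compl_singleton
  exact exists_bound_nonstationary_aux hK hU hα hαβ hβ (fun z hz => ⟨hKV hz, hΨ0 z hz⟩)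
    (hΨ.mono Set.inter_subset_left) (fun z hz => hz.2) N a ha.contDiffOn (fun z _ => ha0 z)

/-- The rescaled Bogoliubov phase, with the dispersion parameter compactified to `m ∈ [0, 1]`. -/
noncomputable def bogPhase (m r : ℝ) : ℝ := r * √(1 - m + m * r ^ 2)

noncomputable def bogPhaseDeriv (m r : ℝ) : ℝ := (1 - m + 2 * m * r ^ 2) / √(1 - m + m * r ^ 2)

noncomputable def bogPhaseDeriv₂ (m r : ℝ) : ℝ :=
  m * r * (3 * (1 - m) + 2 * m * r ^ 2) / ((1 - m + m * r ^ 2) * √(1 - m + m * r ^ 2))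

lemma bogPhase_radicand_ge {m r : ℝ} (hm : m ∈ Set.Icc (0 : ℝ) 1) (hr : 1 / 8 ≤ r) :
    1 / 64 ≤ 1 - m + m * r ^ 2 := by
  have : 1 / 64 ≤ r ^ 2 := by nlinarith
  nlinarith [hm.1, hm.2, mul_le_mul_of_nonneg_left this hm.1]

lemma hasDerivAt_bogPhase {m r : ℝ} (hm : m ∈ Set.Icc (0 : ℝ) 1) (hr : 1 / 8 ≤ r) :
    HasDerivAt (bogPhase m) (bogPhaseDeriv m r) r := by
  have hw := bogPhase_radicand_ge hm hr
  have hw0 : 0 < 1 - m + m * r ^ 2 := by linarith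
  have h1 : HasDerivAt (fun r : ℝ => 1 - m + m * r ^ 2) (m * (2 * r)) r := by
    simpa using (((hasDerivAt_id r).pow 2).const_mul m).const_add (1 - m)
  refine ((hasDerivAt_id r).mul (h1.sqrt hw0.ne')).congr_deriv ?_
  have hs := Real.sqrt_pos.2 hw0
  simp only [bogPhaseDeriv, id]
  field_simp
  rw [Real.sq_sqrt hw0.le]; ring

lemma hasDerivAt_bogPhaseDeriv {m r : ℝ} (hm : m ∈ Set.Icc (0 : ℝ) 1) (hr : 1 / 8 ≤ r) :
    HasDerivAt (bogPhaseDeriv m) (bogPhaseDeriv₂ m r) r := by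
  have hw := bogPhase_radicand_ge hm hr
  have hw0 : 0 < 1 - m + m * r ^ 2 := by linarith
  have h1 : HasDerivAt (fun r : ℝ => 1 - m + m * r ^ 2) (m * (2 * r)) r := by
    simpa using (((hasDerivAt_id r).pow 2).const_mul m).const_add (1 - m)
  have h2 : HasDerivAt (fun r : ℝ => 1 - m + 2 * m * r ^ 2) (2 * m * (2 * r)) r := by
    simpa using (((hasDerivAt_id r).pow 2).const_mul (2 * m)).const_add (1 - m)
  have hs := Real.sqrt_pos.2 hw0
  refine (h2.div (h1.sqrt hw0.ne') hs.ne').congr_deriv ?_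
  simp only [bogPhaseDeriv₂]
  have hsq := Real.sq_sqrt hw0.le
  generalize √(1 - m + m * r ^ 2) = S at *
  rw [← hsq]
  field_simp
  linear_combination (4 * m) * hsq

lemma bogPhaseDeriv_ge {m r : ℝ} (hm : m ∈ Set.Icc (0 : ℝ) 1) (hr : 1 / 8 ≤ r) :
    1 / 8 ≤ bogPhaseDeriv m r := by
  have hw := bogPhase_radicand_ge hm hr
  have hw0 : 0 < 1 - m + m * r ^ 2 := by linarith
  have hs := Real.sqrt_pos.2 hw0
  have h8 : 1 / 8 ≤ √(1 - m + m * r ^ 2) := Real.le_sqrt_of_sq_le (by linarith)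
  rw [bogPhaseDeriv, le_div_iff₀ hs]
  have hsq := Real.sq_sqrt hw0.le
  nlinarith [mul_nonneg hm.1 (sq_nonneg r)]

lemma bogPhaseDeriv₂_ge {m r : ℝ} (hm : m ∈ Set.Icc (0 : ℝ) 1) (hr : r ∈ Set.Icc (1 / 8 : ℝ) 3) :
    m / 6912 ≤ bogPhaseDeriv₂ m r := by
  have hw := bogPhase_radicand_ge hm hr.1
  have hw0 : 0 < 1 - m + m * r ^ 2 := by linarith
  have hs := Real.sqrt_pos.2 hw0
  obtain ⟨hr1, hr2⟩ := hr
  have hr9 : r ^ 2 ≤ 9 := by nlinarith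
  have hr64 : 1 / 64 ≤ r ^ 2 := by nlinarith
  have hw9 : 1 - m + m * r ^ 2 ≤ 9 := by nlinarith [hm.1, hm.2]
  have h3 : √(1 - m + m * r ^ 2) ≤ 3 := Real.sqrt_le_iff.2 ⟨by norm_num, by linarith⟩
  have hden : (1 - m + m * r ^ 2) * √(1 - m + m * r ^ 2) ≤ 27 := by nlinarith
  have hnum : 1 / 32 ≤ 3 * (1 - m) + 2 * m * r ^ 2 := by nlinarith [hm.1, hm.2]
  rw [bogPhaseDeriv₂, le_div_iff₀ (mul_pos hw0 hs)]
  calc m / 6912 * ((1 - m + m * r ^ 2) * √(1 - m + m * r ^ 2)) ≤ m / 6912 * 27 := by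
        have := hm.1; gcongr
    _ = m * (1 / 8) * (1 / 32) := by ring
    _ ≤ _ := by have := hm.1; gcongr

lemma continuousOn_bogPhaseDeriv₂ {m : ℝ} (hm : m ∈ Set.Icc (0 : ℝ) 1) :
    ContinuousOn (bogPhaseDeriv₂ m) (Set.Icc (1 / 8) 3) := by
  unfold bogPhaseDeriv₂
  refine ContinuousOn.div (by fun_prop) (by fun_prop) fun r hr => ?_
  have hw := bogPhase_radicand_ge hm hr.1
  have hw0 : 0 < 1 - m + m * r ^ 2 := by linarith
  exact (mul_pos hw0 (Real.sqrt_pos.2 hw0)).ne'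

/-- Oscillatory integral bound for the Bogoliubov phase with a linear perturbation and a
slowly varying amplitude. -/
lemma exists_bogPhase_vanDerCorput {k k' : ℝ → ℝ}
    (hk : ∀ r ∈ Set.Icc (1 / 8 : ℝ) 3, HasDerivAt k (k' r) r)
    (hk' : ContinuousOn k' (Set.Icc (1 / 8) 3)) (hk0 : k (1 / 8) = 0) (hk1 : k 3 = 0)
    {C : ℝ} (hC : 0 ≤ C) {A A' : ℝ → ℂ}
    (hA : ∀ s ∈ Set.Ici (1 / 128 : ℝ), HasDerivAt A (A' s) s ∧ ‖A s‖ ≤ C ∧ ‖A' s‖ ≤ C / s ^ 2)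
    (hA' : ContinuousOn A' (Set.Ici (1 / 128))) :
    ∃ D : ℝ, 0 ≤ D ∧ ∀ L : ℝ, 0 < L → ∀ m ∈ Set.Ioc (0 : ℝ) 1, ∀ Y : ℝ, 1 / 16 ≤ Y → ∀ σ : ℝ,
      ‖∫ r in (1 / 8 : ℝ)..3, ((k r : ℂ) * A (r * Y)) *
        Complex.exp (Complex.I * (L * bogPhase m r + σ * r : ℝ))‖ ≤ D / √(L * m) := by
  have ck : ContinuousOn k (Set.Icc (1 / 8) 3) :=
    fun r hr => (hk r hr).continuousAt.continuousWithinAt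
  obtain ⟨M, hM⟩ := isCompact_Icc.exists_bound_of_continuousOn ck
  obtain ⟨M', hM'⟩ := isCompact_Icc.exists_bound_of_continuousOn hk'
  have hM0 : 0 ≤ M := (norm_nonneg _).trans (hM 3 (by norm_num))
  have hM0' : 0 ≤ M' := (norm_nonneg _).trans (hM' 3 (by norm_num))
  refine ⟨(2 * Real.pi * (M * C) + (3 - 1 / 8) * (M' * C + M * (1024 * C))) * √6912,
    by have := Real.pi_pos; norm_num; positivity, fun L hL m hm Y hY σ => ?_⟩
  have hm' : m ∈ Set.Icc (0 : ℝ) 1 := ⟨hm.1.le, hm.2⟩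
  have hmem : ∀ r ∈ Set.Icc (1 / 8 : ℝ) 3, r * Y ∈ Set.Ici (1 / 128 : ℝ) := by
    intro r hr
    have := hr.1
    simp only [Set.mem_Ici]; nlinarith
  have cY : ContinuousOn (fun r : ℝ => r * Y) (Set.Icc (1 / 8) 3) := by fun_prop
  have hdA : ∀ r ∈ Set.Icc (1 / 8 : ℝ) 3,
      HasDerivAt (fun r : ℝ => A (r * Y)) (Y * A' (r * Y)) r := by
    intro r hr
    have h1 : HasDerivAt (fun r : ℝ => r * Y) Y r := by
      simpa using (hasDerivAt_id r).mul_const Y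
    have := (hA _ (hmem r hr)).1.scomp r h1
    simpa [Function.comp_def] using this
  have main := norm_integral_exp_le_of_second_deriv (a := 1 / 8) (b := 3) (l := L * m / 6912)
    (M := M * C) (M' := M' * C + M * (1024 * C))
    (φ := fun r => L * bogPhase m r + σ * r)
    (φ' := fun r => L * bogPhaseDeriv m r + σ)
    (φ'' := fun r => L * bogPhaseDeriv₂ m r)
    (g := fun r => (k r : ℂ) * A (r * Y))
    (g' := fun r => (k' r : ℂ) * A (r * Y) + k r * (Y * A' (r * Y)))
    (by norm_num) (by have := hm.1; positivity)
    (fun r hr => (((hasDerivAt_bogPhase hm' hr.1).const_mul L).add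
        ((hasDerivAt_id r).const_mul σ)).congr_deriv (by simp))
    (fun r hr => ((hasDerivAt_bogPhaseDeriv hm' hr.1).const_mul L).add_const σ)
    (continuousOn_const.mul (continuousOn_bogPhaseDeriv₂ hm'))
    (fun r hr => by
      have := bogPhaseDeriv₂_ge hm' hr
      calc L * m / 6912 = L * (m / 6912) := by ring
        _ ≤ _ := by gcongr)
    (fun r hr => ((hk r hr).ofReal_comp).mul (hdA r hr))
    (((Complex.continuous_ofReal.comp_continuousOn hk').mul
      (fun r hr => (hdA r hr).continuousAt.continuousWithinAt)).add
      ((Complex.continuous_ofReal.comp_continuousOn ck).mul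
        (continuousOn_const.mul (hA'.comp cY hmem))))
    (by simp only [hk0, Complex.ofReal_zero, zero_mul])
    (by simp only [hk1, Complex.ofReal_zero, zero_mul])
    (fun r hr => by
      rw [norm_mul, Complex.norm_real]
      have := hM r hr; have := (hA _ (hmem r hr)).2.1
      gcongr)
    (fun r hr => by
      refine (norm_add_le _ _).trans ?_
      rw [norm_mul, norm_mul, norm_mul, Complex.norm_real, Complex.norm_real, Complex.norm_real]
      have h1 := hM r hr; have h2 := hM' r hr; have h3 := (hA _ (hmem r hr)).2.1
      have h4 := (hA _ (hmem r hr)).2.2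
      have hY0 : 0 < Y := by linarith
      have hr0 : 0 < r := by linarith [hr.1]
      have h5 : ‖Y‖ * ‖A' (r * Y)‖ ≤ 1024 * C := by
        rw [Real.norm_eq_abs, abs_of_pos hY0]
        calc Y * ‖A' (r * Y)‖ ≤ Y * (C / (r * Y) ^ 2) := by gcongr
          _ = C / (r ^ 2 * Y) := by field_simp
          _ ≤ C / ((1 / 8) ^ 2 * (1 / 16)) := by
              have := hr.1; gcongr
          _ = 1024 * C := by ring
      gcongr)
  refine main.trans (le_of_eq ?_)
  rw [Real.sqrt_div' _ (by norm_num)]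
  field_simp

lemma intervalIntegral_swap_of_continuous {E : Type*} [NormedAddCommGroup E] [NormedSpace ℝ E]
    {f : ℝ → ℝ → E} (hf : Continuous (Function.uncurry f)) {a b c d : ℝ} (hab : a ≤ b)
    (hcd : c ≤ d) :
    ∫ x in a..b, ∫ y in c..d, f x y = ∫ y in c..d, ∫ x in a..b, f x y := by
  simp only [intervalIntegral.integral_of_le hab, intervalIntegral.integral_of_le hcd]
  refine integral_integral_swap ?_
  rw [Measure.prod_restrict]
  exact (hf.continuousOn.integrableOn_compact (isCompact_Icc.prod isCompact_Icc)).mono_set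
    (Set.prod_mono Set.Ioc_subset_Icc_self Set.Ioc_subset_Icc_self)

lemma continuous_bogPhase (m : ℝ) : Continuous (bogPhase m) := by
  unfold bogPhase; fun_prop

/-- The radial oscillatory integral in the region without stationary points. -/
lemma exists_bogPhase_nonstationary (n N : ℕ) {k : ℝ → ℝ} (hk : ContDiff ℝ (⊤ : ℕ∞) k)
    (hk0 : ∀ r, r < 1 / 4 ∨ 9 / 4 < r → k r = 0) :
    ∃ C : ℝ, ∀ L : ℝ, 0 < L → ∀ m ∈ Set.Icc (0 : ℝ) 1, ∀ Y : ℝ, 0 ≤ Y → Y ≤ L / 16 →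
      ‖∫ r in (1 / 8 : ℝ)..3, ((k r : ℂ) * Complex.exp (Complex.I * (L * bogPhase m r : ℝ))) *
        cosIntegral (fun θ => Real.sin θ ^ n) (r * Y)‖ ≤ C / L ^ N := by
  set Ψ : (ℝ × ℝ) × ℝ → ℝ := fun z => bogPhase z.1.1 z.2 + z.1.2 * z.2 with hΨ
  set V : Set ((ℝ × ℝ) × ℝ) := {z | 0 < 1 - z.1.1 + z.1.1 * z.2 ^ 2} with hV
  have cΨ : ContDiffOn ℝ (⊤ : ℕ∞) Ψ V := by
    simp only [hΨ, bogPhase]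
    refine ContDiffOn.add (ContDiffOn.mul (by fun_prop) (ContDiffOn.sqrt (by fun_prop) ?_))
      (by fun_prop)
    intro z hz; exact ne_of_gt hz
  have oV : IsOpen V := isOpen_lt continuous_const (by fun_prop)
  have hKV : (Set.Icc (0 : ℝ) 1 ×ˢ Set.Icc (-(1 / 16) : ℝ) (1 / 16)) ×ˢ Set.Icc (1 / 8 : ℝ) 3 ⊆
      V := by
    rintro ⟨⟨m, b⟩, r⟩ ⟨⟨hm, hb⟩, hr⟩
    have := bogPhase_radicand_ge hm hr.1
    show 0 < 1 - m + m * r ^ 2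
    linarith
  obtain ⟨C, hC⟩ := exists_bound_nonstationary (isCompact_Icc.prod isCompact_Icc) oV
    (α := 1 / 8) (α' := 1 / 4) (β' := 9 / 4) (β := 3) (by norm_num) (by norm_num) (by norm_num)
    hKV cΨ (by
      rintro ⟨⟨m, b⟩, r⟩ hz
      have hz' := hKV hz
      obtain ⟨⟨hm, hb⟩, hr⟩ := hz
      have h1 := hasDerivAt_slice
        ((cΨ.contDiffAt (oV.mem_nhds hz')).differentiableAt (by simp))
      have h2 : HasDerivAt (fun r => Ψ ((m, b), r)) (bogPhaseDeriv m r + b) r :=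
        ((hasDerivAt_bogPhase hm hr.1).add ((hasDerivAt_id r).const_mul b)).congr_deriv (by simp)
      rw [h1.unique h2]
      have := bogPhaseDeriv_ge hm hr.1
      have := hb.1
      dsimp only at this
      linarith) N (a := fun z => (k z.2 : ℂ))
    (Complex.ofRealCLM.contDiff.comp (hk.comp contDiff_snd))
    (fun z hz => by simp [hk0 z.2 hz])
  refine ⟨C * Real.pi, fun L hL m hm Y hY0 hY => ?_⟩
  have hcont : Continuous (Function.uncurry fun r θ : ℝ =>
      ((k r : ℂ) * Complex.exp (Complex.I * (L * bogPhase m r : ℝ))) *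
      (((Real.sin θ ^ n : ℝ) : ℂ) * Complex.exp (Complex.I * (r * Y * Real.cos θ : ℝ)))) := by
    have := continuous_bogPhase m
    have := hk.continuous
    simp only [Function.uncurry_def]
    fun_prop
  have hrew : ∫ r in (1 / 8 : ℝ)..3, ((k r : ℂ) *
        Complex.exp (Complex.I * (L * bogPhase m r : ℝ))) *
        cosIntegral (fun θ => Real.sin θ ^ n) (r * Y) =
      ∫ θ in (0 : ℝ)..Real.pi, ((Real.sin θ ^ n : ℝ) : ℂ) * ∫ r in (1 / 8 : ℝ)..3, (k r : ℂ) *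
        Complex.exp (Complex.I * (L * Ψ ((m, Y * Real.cos θ / L), r) : ℝ)) := by
    simp only [cosIntegral, ← intervalIntegral.integral_const_mul]
    rw [intervalIntegral_swap_of_continuous hcont (by norm_num) Real.pi_pos.le]
    congr 1; ext θ; congr 1; ext r
    have : Complex.exp (Complex.I * (L * Ψ ((m, Y * Real.cos θ / L), r) : ℝ)) =
        Complex.exp (Complex.I * (L * bogPhase m r : ℝ)) *
          Complex.exp (Complex.I * (r * Y * Real.cos θ : ℝ)) := by
      rw [← Complex.exp_add]
      congr 1
      simp only [hΨ]
      have : (L : ℂ) ≠ 0 := by exact_mod_cast hL.ne'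
      push_cast; field_simp
    rw [this]; ring
  rw [hrew]
  have := intervalIntegral.norm_integral_le_of_norm_le_const (a := 0) (b := Real.pi)
    (C := C / L ^ N)
    (f := fun θ => ((Real.sin θ ^ n : ℝ) : ℂ) * ∫ r in (1 / 8 : ℝ)..3, (k r : ℂ) *
        Complex.exp (Complex.I * (L * Ψ ((m, Y * Real.cos θ / L), r) : ℝ)))
    (fun θ _ => by
      have h1 : ‖((Real.sin θ ^ n : ℝ) : ℂ)‖ ≤ 1 := by
        rw [Complex.norm_real, norm_pow]
        exact pow_le_one₀ (norm_nonneg _) (Real.abs_sin_le_one θ)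
      have h2 := hC (m, Y * Real.cos θ / L) ⟨hm, by
        have := Real.cos_le_one θ
        have := Real.neg_one_le_cos θ
        constructor
        · rw [le_div_iff₀ hL]; nlinarith
        · rw [div_le_iff₀ hL]; nlinarith⟩ L hL
      rw [norm_mul]
      calc _ ≤ 1 * (C / L ^ N) := by gcongr
        _ = _ := one_mul _)
  refine this.trans (le_of_eq ?_)
  rw [sub_zero, abs_of_pos Real.pi_pos]; ring

/-- The radial oscillatory integral in the region where stationary points may occur. -/
lemma exists_bogPhase_stationary (n : ℕ) {k : ℝ → ℝ} (hk : ContDiff ℝ (⊤ : ℕ∞) k)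
    (hk0 : ∀ r, r < 1 / 4 ∨ 9 / 4 < r → k r = 0) :
    ∃ C : ℝ, 0 ≤ C ∧ ∀ L : ℝ, 0 < L → ∀ m ∈ Set.Ioc (0 : ℝ) 1, ∀ Y : ℝ, 1 / 16 ≤ Y →
      ‖∫ r in (1 / 8 : ℝ)..3, ((k r : ℂ) * Complex.exp (Complex.I * (L * bogPhase m r : ℝ))) *
        cosIntegral (fun θ => Real.sin θ ^ n) (r * Y)‖ ≤
        C * Y ^ (-(((n : ℝ) + 1) / 2)) / √(L * m) := by
  set α : ℝ := ((n : ℝ) + 1) / 2 with hα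
  obtain ⟨C, hC, A, A', B, B', hAB, cA, cB⟩ :=
    exists_cosIntegral_decomposition n (s₀ := 1 / 128) (by norm_num)
  have hkd : ∀ r ∈ Set.Icc (1 / 8 : ℝ) 3, HasDerivAt (fun r => k r * r ^ (-α))
      (deriv k r * r ^ (-α) + k r * (-α * r ^ (-α - 1))) r := by
    intro r hr
    have hr0 : r ≠ 0 := by have := hr.1; positivity
    exact ((hk.differentiable (by simp)) r).hasDerivAt.mul
      (Real.hasDerivAt_rpow_const (Or.inl hr0))
  have hrp : ∀ β : ℝ, ContinuousOn (fun r : ℝ => r ^ β) (Set.Icc (1 / 8) 3) := by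
    intro β r hr
    have hr0 : r ≠ 0 := by have := hr.1; positivity
    exact (Real.continuousAt_rpow_const _ _ (Or.inl hr0)).continuousWithinAt
  have hkc : ContinuousOn (fun r => deriv k r * r ^ (-α) + k r * (-α * r ^ (-α - 1)))
      (Set.Icc (1 / 8) 3) :=
    (((hk.continuous_deriv (by simp)).continuousOn).mul (hrp _)).add
      (hk.continuous.continuousOn.mul (continuousOn_const.mul (hrp _)))
  have e1 : k (1 / 8) * (1 / 8) ^ (-α) = 0 := by rw [hk0 _ (Or.inl (by norm_num)), zero_mul]
  have e2 : k 3 * 3 ^ (-α) = 0 := by rw [hk0 _ (Or.inr (by norm_num)), zero_mul]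
  obtain ⟨D₁, hD₁, h₁⟩ := exists_bogPhase_vanDerCorput hkd hkc e1 e2 hC
    (fun s hs => ⟨(hAB s hs).1, (hAB s hs).2.2.1, (hAB s hs).2.2.2.2.1⟩) cA
  obtain ⟨D₂, hD₂, h₂⟩ := exists_bogPhase_vanDerCorput hkd hkc e1 e2 hC
    (fun s hs => ⟨(hAB s hs).2.1, (hAB s hs).2.2.2.1, (hAB s hs).2.2.2.2.2.1⟩) cB
  refine ⟨D₁ + D₂, add_nonneg hD₁ hD₂, fun L hL m hm Y hY => ?_⟩
  have hY0 : 0 < Y := by linarith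
  have hmem : ∀ r ∈ Set.Icc (1 / 8 : ℝ) 3, r * Y ∈ Set.Ici (1 / 128 : ℝ) := by
    intro r hr
    have := hr.1
    simp only [Set.mem_Ici]; nlinarith
  have cY : ContinuousOn (fun r : ℝ => r * Y) (Set.Icc (1 / 8) 3) := by fun_prop
  have hI : ∀ (G G' : ℝ → ℂ) (σ : ℝ), (∀ s ∈ Set.Ici (1 / 128 : ℝ), HasDerivAt G (G' s) s) →
      IntervalIntegrable (fun r => (((k r * r ^ (-α) : ℝ) : ℂ) * G (r * Y)) *
        Complex.exp (Complex.I * (L * bogPhase m r + σ * r : ℝ))) volume (1 / 8) 3 := by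
    intro G G' σ hG
    refine ContinuousOn.intervalIntegrable ?_
    rw [Set.uIcc_of_le (by norm_num)]
    have := continuous_bogPhase m
    have cG : ContinuousOn G (Set.Ici (1 / 128)) :=
      fun s hs => (hG s hs).continuousAt.continuousWithinAt
    exact ((Complex.continuous_ofReal.comp_continuousOn
      (hk.continuous.continuousOn.mul (hrp _))).mul (cG.comp cY hmem)).mul
      (Continuous.continuousOn (by fun_prop))
  have hrew : ∫ r in (1 / 8 : ℝ)..3, ((k r : ℂ) *
      Complex.exp (Complex.I * (L * bogPhase m r : ℝ))) *
        cosIntegral (fun θ => Real.sin θ ^ n) (r * Y) =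
      ((Y ^ (-α) : ℝ) : ℂ) * ((∫ r in (1 / 8 : ℝ)..3, (((k r * r ^ (-α) : ℝ) : ℂ) * A (r * Y)) *
        Complex.exp (Complex.I * (L * bogPhase m r + Y * r : ℝ))) +
      ∫ r in (1 / 8 : ℝ)..3, (((k r * r ^ (-α) : ℝ) : ℂ) * B (r * Y)) *
        Complex.exp (Complex.I * (L * bogPhase m r + -Y * r : ℝ))) := by
    rw [← intervalIntegral.integral_add (hI A A' Y fun s hs => (hAB s hs).1)
      (hI B B' (-Y) fun s hs => (hAB s hs).2.1), ← intervalIntegral.integral_const_mul]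
    refine intervalIntegral.integral_congr fun r hr => ?_
    rw [Set.uIcc_of_le (by norm_num)] at hr
    have hr0 : 0 < r := by have := hr.1; positivity
    have e3 : Complex.exp (Complex.I * (L * bogPhase m r + Y * r : ℝ)) =
        Complex.exp (Complex.I * (L * bogPhase m r : ℝ)) *
          Complex.exp (Complex.I * (r * Y : ℝ)) := by
      rw [← Complex.exp_add]; congr 1; push_cast; ring
    have e4 : Complex.exp (Complex.I * (L * bogPhase m r + -Y * r : ℝ)) =
        Complex.exp (Complex.I * (L * bogPhase m r : ℝ)) *
          Complex.exp (Complex.I * (-(r * Y) : ℝ)) := by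
      rw [← Complex.exp_add]; congr 1; push_cast; ring
    rw [(hAB _ (hmem r hr)).2.2.2.2.2.2, e3, e4, Real.mul_rpow hr0.le hY0.le]
    push_cast; ring
  rw [hrew, norm_mul, Complex.norm_real, Real.norm_eq_abs,
    abs_of_nonneg (Real.rpow_nonneg hY0.le _)]
  calc _ ≤ Y ^ (-α) * (D₁ / √(L * m) + D₂ / √(L * m)) := by
        have := Real.rpow_nonneg hY0.le (-α)
        gcongr
        exact (norm_add_le _ _).trans (add_le_add (h₁ L hL m hm Y hY Y) (h₂ L hL m hm Y hY (-Y)))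
    _ = _ := by ring

/-- Uniform decay of the radial oscillatory integral. -/
lemma exists_bogPhase_decay (n : ℕ) {k : ℝ → ℝ} (hk : ContDiff ℝ (⊤ : ℕ∞) k)
    (hk0 : ∀ r, r < 1 / 4 ∨ 9 / 4 < r → k r = 0) :
    ∃ C : ℝ, 0 ≤ C ∧ ∀ L : ℝ, 0 < L → ∀ m ∈ Set.Ioc (0 : ℝ) 1, ∀ Y : ℝ, 0 ≤ Y →
      ‖∫ r in (1 / 8 : ℝ)..3, ((k r : ℂ) * Complex.exp (Complex.I * (L * bogPhase m r : ℝ))) *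
        cosIntegral (fun θ => Real.sin θ ^ n) (r * Y)‖ ≤
        C * L ^ (-(((n : ℝ) + 2) / 2)) / √m := by
  obtain ⟨C₁, h₁⟩ := exists_bogPhase_nonstationary n (n + 2) hk hk0
  obtain ⟨C₂, hC₂, h₂⟩ := exists_bogPhase_stationary n hk hk0
  obtain ⟨M, hM⟩ := (isCompact_Icc (a := (1 / 8 : ℝ)) (b := 3)).exists_bound_of_continuousOn
    hk.continuous.continuousOn
  have hM0 : 0 ≤ M := (norm_nonneg _).trans (hM 3 (by norm_num))
  have hpi := Real.pi_pos
  refine ⟨M * Real.pi * 3 + |C₁| + C₂ * (1 / 16) ^ (-(((n : ℝ) + 1) / 2)), by positivity,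
    fun L hL m hm Y hY => ?_⟩
  have hsm : 0 < √m := Real.sqrt_pos.2 hm.1
  have hsm1 : √m ≤ 1 := Real.sqrt_le_one.2 hm.2
  have hP : 0 < L ^ (-(((n : ℝ) + 2) / 2)) := Real.rpow_pos_of_pos hL _
  have h16 : 0 < (1 / 16 : ℝ) ^ (-(((n : ℝ) + 1) / 2)) := Real.rpow_pos_of_pos (by norm_num) _
  have hdiv : ∀ x y : ℝ, 0 ≤ y → x ≤ y → x ≤ y / √m := by
    intro x y hy hxy
    exact hxy.trans (le_div_self hy hsm hsm1)
  have hac := abs_nonneg C₁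
  have t1 : 0 ≤ M * Real.pi * 3 := by positivity
  have t3 : 0 ≤ C₂ * (1 / 16 : ℝ) ^ (-(((n : ℝ) + 1) / 2)) := by positivity
  rcases le_total L 1 with hL1 | hL1
  · have hone : 1 ≤ L ^ (-(((n : ℝ) + 2) / 2)) :=
      Real.one_le_rpow_of_pos_of_le_one_of_nonpos hL hL1 (by
        have : (0 : ℝ) ≤ n := n.cast_nonneg
        linarith)
    refine hdiv _ _ (by positivity) ?_
    have := intervalIntegral.norm_integral_le_of_norm_le_const (a := 1 / 8) (b := 3)
      (C := M * Real.pi)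
      (f := fun r => ((k r : ℂ) * Complex.exp (Complex.I * (L * bogPhase m r : ℝ))) *
        cosIntegral (fun θ => Real.sin θ ^ n) (r * Y)) (fun r hr => by
        rw [Set.uIoc_of_le (by norm_num)] at hr
        have h1 := hM r ⟨hr.1.le, hr.2⟩
        have h2 := norm_cosIntegral_sin_pow_le n (r * Y)
        rw [norm_mul, norm_mul, mul_comm Complex.I, Complex.norm_exp_ofReal_mul_I, mul_one,
          Complex.norm_real]
        gcongr)
    calc _ ≤ M * Real.pi * |3 - 1 / 8| := this
      _ ≤ M * Real.pi * 3 * 1 := by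
          rw [mul_one, abs_of_pos (by norm_num)]
          have : 0 ≤ M * Real.pi := by positivity
          nlinarith
      _ ≤ _ := by gcongr; linarith
  · rcases le_total Y (L / 16) with hYL | hYL
    · refine hdiv _ _ (by positivity) ?_
      refine (h₁ L hL m ⟨hm.1.le, hm.2⟩ Y hY hYL).trans ?_
      have : (L ^ (n + 2))⁻¹ ≤ L ^ (-(((n : ℝ) + 2) / 2)) := by
        rw [← Real.rpow_natCast, ← Real.rpow_neg hL.le]
        refine Real.rpow_le_rpow_of_exponent_le hL1 ?_
        have : (0 : ℝ) ≤ n := n.cast_nonneg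
        push_cast; linarith
      rw [div_eq_mul_inv]
      calc C₁ * (L ^ (n + 2))⁻¹ ≤ |C₁| * L ^ (-(((n : ℝ) + 2) / 2)) := by
            gcongr; exact le_abs_self _
        _ ≤ _ := by gcongr; linarith
    · refine (h₂ L hL m hm Y (by linarith)).trans ?_
      rw [Real.sqrt_mul hL.le, ← div_div]
      gcongr
      have hYp : Y ^ (-(((n : ℝ) + 1) / 2)) ≤ (L / 16) ^ (-(((n : ℝ) + 1) / 2)) :=
        Real.rpow_le_rpow_of_nonpos (by positivity) hYL (by
          have : (0 : ℝ) ≤ n := n.cast_nonneg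
          linarith)
      have hsplit : (L / 16) ^ (-(((n : ℝ) + 1) / 2)) / √L =
          (1 / 16 : ℝ) ^ (-(((n : ℝ) + 1) / 2)) * L ^ (-(((n : ℝ) + 2) / 2)) := by
        rw [div_eq_mul_one_div L, mul_comm L, Real.mul_rpow (by norm_num) hL.le,
          Real.sqrt_eq_rpow, mul_div_assoc, ← Real.rpow_sub hL]
        congr 2; ring
      calc C₂ * Y ^ (-(((n : ℝ) + 1) / 2)) / √L
          ≤ C₂ * (L / 16) ^ (-(((n : ℝ) + 1) / 2)) / √L := by gcongr
        _ = C₂ * (1 / 16 : ℝ) ^ (-(((n : ℝ) + 1) / 2)) * L ^ (-(((n : ℝ) + 2) / 2)) := by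
            rw [mul_div_assoc, hsplit]; ring
        _ ≤ _ := by gcongr; linarith

lemma exists_orthonormalBasis_eq_norm_smul (n : ℕ) (x : EuclideanSpace ℝ (Fin (n + 2))) :
    ∃ b : OrthonormalBasis (Fin (n + 2)) ℝ (EuclideanSpace ℝ (Fin (n + 2))),
      x = ‖x‖ • b 0 := by
  by_cases hx : x = 0
  · exact ⟨EuclideanSpace.basisFun _ ℝ, by simp [hx]⟩
  have hx' : ‖x‖ ≠ 0 := norm_ne_zero_iff.mpr hx
  have hv : Orthonormal ℝ (Set.domRestrict ({0} : Set (Fin (n + 2)))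
      (fun _ => ‖x‖⁻¹ • x)) := by
    constructor
    · intro i
      simp [Set.domRestrict, norm_smul, hx']
    · intro i j hij
      exact absurd (Subsingleton.elim i j) hij
  obtain ⟨b, hb⟩ := hv.exists_orthonormalBasis_extension_of_card_eq (by simp)
  refine ⟨b, ?_⟩
  rw [hb 0 rfl, smul_smul, mul_inv_cancel₀ hx', one_smul]

lemma integral_radial_mul_exp_inner_eq (n : ℕ) (G : ℝ → ℂ) (x : EuclideanSpace ℝ (Fin (n + 2))) :
    ∫ ξ : EuclideanSpace ℝ (Fin (n + 2)),
        G ‖ξ‖ * Complex.exp (Complex.I * (inner ℝ x ξ : ℝ)) =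
      ∫ p : ℝ × EuclideanSpace ℝ (Fin (n + 1)),
        G √(p.1 ^ 2 + ‖p.2‖ ^ 2) * Complex.exp (Complex.I * (‖x‖ * p.1 : ℝ)) := by
  obtain ⟨b, hb⟩ := exists_orthonormalBasis_eq_norm_smul n x
  have h₁ := b.measurePreserving_repr
  have h₂ := EuclideanSpace.volume_preserving_symm_measurableEquiv_toLp (Fin (n + 2))
  have h₃ := volume_preserving_piFinSuccAbove (fun _ : Fin (n + 2) => ℝ) 0
  have h₄ : MeasurePreserving (Prod.map (id : ℝ → ℝ)
      (MeasurableEquiv.toLp 2 (Fin (n + 1) → ℝ))) volume volume :=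
    (MeasurePreserving.id volume).prod
      (EuclideanSpace.volume_preserving_symm_measurableEquiv_toLp (Fin (n + 1))).symm
  let e : EuclideanSpace ℝ (Fin (n + 2)) ≃ᵐ ℝ × EuclideanSpace ℝ (Fin (n + 1)) :=
    (b.repr.toHomeomorph.toMeasurableEquiv.trans
      (MeasurableEquiv.toLp 2 (Fin (n + 2) → ℝ)).symm).trans
      ((MeasurableEquiv.piFinSuccAbove (fun _ : Fin (n + 2) => ℝ) 0).trans
        ((MeasurableEquiv.refl ℝ).prodCongr (MeasurableEquiv.toLp 2 (Fin (n + 1) → ℝ))))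
  have he : MeasurePreserving e volume volume := h₄.comp (h₃.comp (h₂.comp h₁))
  have he₁ : ∀ ξ, (e ξ).1 = b.repr ξ 0 := fun ξ => rfl
  have he₂ : ∀ ξ i, (e ξ).2 i = b.repr ξ (Fin.succ i) := fun ξ i => rfl
  rw [← he.integral_comp']
  congr 1
  ext ξ
  have hn : √((e ξ).1 ^ 2 + ‖(e ξ).2‖ ^ 2) = ‖ξ‖ := by
    rw [← b.repr.norm_map ξ, EuclideanSpace.norm_eq (b.repr ξ), EuclideanSpace.norm_sq_eq,
      he₁]
    simp only [he₂, Real.norm_eq_abs, sq_abs]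
    rw [Fin.sum_univ_succ (fun i => (b.repr ξ) i ^ 2)]
  have hi : (inner ℝ x ξ : ℝ) = ‖x‖ * (e ξ).1 := by
    rw [he₁, b.repr_apply_apply]
    conv_lhs => rw [hb]
    rw [inner_smul_left]
    rfl
  rw [hn, hi]

lemma integral_prod_norm_eq (n : ℕ) {G : ℝ → ℂ} (hG : Continuous G) {B : ℝ}
    (hB : ∀ r, B < r → G r = 0) (Y : ℝ) :
    ∫ p : ℝ × EuclideanSpace ℝ (Fin (n + 1)),
        G √(p.1 ^ 2 + ‖p.2‖ ^ 2) * Complex.exp (Complex.I * (Y * p.1 : ℝ)) =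
      ((n + 1 : ℕ) * (volume.real (Metric.ball (0 : EuclideanSpace ℝ (Fin (n + 1))) 1)) : ℝ) *
      ∫ p : ℝ × ℝ, {p : ℝ × ℝ | 0 < p.2}.indicator (fun p =>
        (p.2 ^ n : ℝ) * (G √(p.1 ^ 2 + p.2 ^ 2) * Complex.exp (Complex.I * (Y * p.1 : ℝ)))) p := by
  have hzero : ∀ {F : Type} [NormedAddCommGroup F] (p : ℝ × F), p ∉ Metric.closedBall 0 B →
      G √(p.1 ^ 2 + ‖p.2‖ ^ 2) = 0 := by
    intro F _ p hp
    apply hB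
    have hp' : B < ‖p‖ := by simpa using hp
    refine hp'.trans_le ?_
    rw [Prod.norm_def]
    apply max_le
    · rw [Real.norm_eq_abs]
      exact Real.abs_le_sqrt (by nlinarith [sq_nonneg ‖p.2‖])
    · nth_rw 1 [← abs_norm p.2]
      exact Real.abs_le_sqrt (by nlinarith [sq_nonneg p.1])
  have hi₁ : Integrable (fun p : ℝ × EuclideanSpace ℝ (Fin (n + 1)) =>
      G √(p.1 ^ 2 + ‖p.2‖ ^ 2) * Complex.exp (Complex.I * (Y * p.1 : ℝ)))
      (volume.prod volume) := by
    refine Continuous.integrable_of_hasCompactSupport (by fun_prop) ?_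
    refine HasCompactSupport.intro (isCompact_closedBall 0 B) fun p hp => ?_
    rw [hzero p hp, zero_mul]
  have hi₂ : Integrable ({p : ℝ × ℝ | 0 < p.2}.indicator (fun p =>
        (p.2 ^ n : ℝ) * (G √(p.1 ^ 2 + p.2 ^ 2) * Complex.exp (Complex.I * (Y * p.1 : ℝ)))))
      (volume.prod volume) := by
    refine Integrable.indicator ?_ (measurableSet_lt measurable_const measurable_snd)
    refine Continuous.integrable_of_hasCompactSupport (by fun_prop) ?_
    refine HasCompactSupport.intro (isCompact_closedBall 0 B) fun p hp => ?_
    have := hzero p hp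
    rw [Real.norm_eq_abs, sq_abs] at this
    rw [this]
    simp
  rw [Measure.volume_eq_prod, Measure.volume_eq_prod, integral_prod _ hi₁, integral_prod _ hi₂,
    ← integral_const_mul]
  congr 1
  ext t
  have := integral_fun_norm_addHaar (volume : Measure (EuclideanSpace ℝ (Fin (n + 1))))
    (fun s => G √(t ^ 2 + s ^ 2) * Complex.exp (Complex.I * (Y * t : ℝ)))
  simp only at this ⊢
  rw [this, ← integral_indicator measurableSet_Ioi]
  simp only [finrank_euclideanSpace, Fintype.card_fin, Nat.add_sub_cancel, nsmul_eq_mul,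
    Complex.real_smul]
  push_cast
  rw [mul_assoc]
  rfl

lemma integral_halfplane_eq_polar (n : ℕ) {G : ℝ → ℂ} (hG : Continuous G) {B : ℝ} (hB₀ : 0 ≤ B)
    (hB : ∀ r, B < r → G r = 0) (Y : ℝ) :
    ∫ p : ℝ × ℝ, {p : ℝ × ℝ | 0 < p.2}.indicator (fun p =>
        (p.2 ^ n : ℝ) * (G √(p.1 ^ 2 + p.2 ^ 2) * Complex.exp (Complex.I * (Y * p.1 : ℝ)))) p =
      ∫ r in (0 : ℝ)..B, (r ^ (n + 1) : ℝ) * G r *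
        cosIntegral (fun θ => Real.sin θ ^ n) (r * Y) := by
  rw [← integral_comp_polarCoord_symm]
  have hsub : Set.Ioc 0 B ×ˢ Set.Ioo 0 Real.pi ⊆ polarCoord.target := by
    intro p hp
    exact ⟨hp.1.1, by linarith [hp.2.1, Real.pi_pos], hp.2.2⟩
  have hmeas : MeasurableSet (Set.Ioc 0 B ×ˢ Set.Ioo 0 Real.pi) :=
    measurableSet_Ioc.prod measurableSet_Ioo
  rw [setIntegral_eq_of_subset_of_forall_sdiff_eq_zero
    polarCoord.open_target.measurableSet hsub]
  · let H : ℝ × ℝ → ℂ := fun p => ((p.1 ^ (n + 1) : ℝ) * G p.1) *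
      ((Real.sin p.2 ^ n : ℝ) * Complex.exp (Complex.I * (p.1 * Y * Real.cos p.2 : ℝ)))
    have hH : Continuous H := by fun_prop
    have hHi : IntegrableOn H (Set.Ioc 0 B ×ˢ Set.Ioo 0 Real.pi) (volume.prod volume) :=
      (hH.continuousOn.integrableOn_compact (isCompact_Icc.prod isCompact_Icc)).mono_set
        (Set.prod_mono Set.Ioc_subset_Icc_self Set.Ioo_subset_Icc_self)
    rw [setIntegral_congr_fun (g := H) hmeas, Measure.volume_eq_prod, setIntegral_prod _ hHi,
      intervalIntegral.integral_of_le hB₀]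
    · congr 1
      ext r
      simp only [H]
      rw [integral_const_mul, cosIntegral, intervalIntegral.integral_of_le Real.pi_pos.le,
        integral_Ioc_eq_integral_Ioo]
    · intro p hp
      have hs : 0 < Real.sin p.2 := Real.sin_pos_of_pos_of_lt_pi hp.2.1 hp.2.2
      have hr : 0 < p.1 := hp.1.1
      have hmem : ((polarCoord.symm p : ℝ × ℝ)) ∈ {p : ℝ × ℝ | 0 < p.2} := by
        simpa [polarCoord_symm_apply] using mul_pos hr hs
      have hsq : √((p.1 * Real.cos p.2) ^ 2 + (p.1 * Real.sin p.2) ^ 2) = p.1 := by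
        rw [show (p.1 * Real.cos p.2) ^ 2 + (p.1 * Real.sin p.2) ^ 2 = p.1 ^ 2 by
          rw [mul_pow, mul_pow, ← mul_add, Real.cos_sq_add_sin_sq, mul_one], Real.sqrt_sq hr.le]
      simp only [Set.indicator_of_mem hmem, H]
      simp only [polarCoord_symm_apply, hsq, Complex.real_smul]
      rw [show Y * (p.1 * Real.cos p.2) = p.1 * Y * Real.cos p.2 by ring]
      push_cast
      ring
  · intro p hp
    obtain ⟨⟨hr, hθ₁, hθ₂⟩, hp'⟩ := hp
    have hr : 0 < p.1 := hr
    by_cases hs : 0 < p.1 * Real.sin p.2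
    · have hs' : 0 < Real.sin p.2 := pos_of_mul_pos_right hs hr.le
      have hθ : 0 < p.2 := by
        by_contra h
        exact absurd (Real.sin_nonpos_of_nonpos_of_neg_pi_le (not_lt.mp h) hθ₁.le) (not_le.mpr hs')
      have hrB : B < p.1 := by
        by_contra h
        exact hp' ⟨⟨hr, not_lt.mp h⟩, hθ, hθ₂⟩
      have hsq : √((p.1 * Real.cos p.2) ^ 2 + (p.1 * Real.sin p.2) ^ 2) = p.1 := by
        rw [show (p.1 * Real.cos p.2) ^ 2 + (p.1 * Real.sin p.2) ^ 2 = p.1 ^ 2 by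
          rw [mul_pow, mul_pow, ← mul_add, Real.cos_sq_add_sin_sq, mul_one], Real.sqrt_sq hr.le]
      have hmem : ((polarCoord.symm p : ℝ × ℝ)) ∈ {p : ℝ × ℝ | 0 < p.2} := by
        simpa [polarCoord_symm_apply] using hs
      rw [Set.indicator_of_mem hmem]
      simp [polarCoord_symm_apply, hsq, hB _ hrB]
    · have hmem : ((polarCoord.symm p : ℝ × ℝ)) ∉ {p : ℝ × ℝ | 0 < p.2} := by
        simpa [polarCoord_symm_apply] using hs
      rw [Set.indicator_of_notMem hmem, smul_zero]

/-- Fourier integrals of compactly supported radial functions. -/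
lemma integral_radial_mul_exp_inner (n : ℕ) {G : ℝ → ℂ} (hG : Continuous G) {B : ℝ} (hB₀ : 0 ≤ B)
    (hB : ∀ r, B < r → G r = 0) (x : EuclideanSpace ℝ (Fin (n + 2))) :
    ∫ ξ : EuclideanSpace ℝ (Fin (n + 2)),
        G ‖ξ‖ * Complex.exp (Complex.I * (inner ℝ x ξ : ℝ)) =
      ((n + 1 : ℕ) * (volume.real (Metric.ball (0 : EuclideanSpace ℝ (Fin (n + 1))) 1)) : ℝ) *
      ∫ r in (0 : ℝ)..B, (r ^ (n + 1) : ℝ) * G r *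
        cosIntegral (fun θ => Real.sin θ ^ n) (r * ‖x‖) := by
  rw [integral_radial_mul_exp_inner_eq, integral_prod_norm_eq n hG hB,
    integral_halfplane_eq_polar n hG hB₀ hB]

lemma exists_annulus_cutoff :
    ∃ χ : ℝ → ℝ, ContDiff ℝ (⊤ : ℕ∞) χ ∧ (∀ r, 1 / 2 ≤ r → r ≤ 2 → χ r = 1) ∧
      (∀ r, r < 1 / 4 ∨ 9 / 4 < r → χ r = 0) ∧ ∀ r, |χ r| ≤ 1 := by
  let χ : ContDiffBump (5 / 4 : ℝ) := ⟨3 / 4, 1, by norm_num, by norm_num⟩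
  refine ⟨χ, χ.contDiff, fun r h₁ h₂ => χ.one_of_mem_closedBall ?_, fun r hr =>
    χ.zero_of_le_dist ?_, fun r => ?_⟩
  · rw [Metric.mem_closedBall, Real.dist_eq, abs_le]
    change -(3 / 4 : ℝ) ≤ _ ∧ _ ≤ (3 / 4 : ℝ)
    constructor <;> linarith
  · rw [Real.dist_eq, le_abs]
    change (1 : ℝ) ≤ _ ∨ (1 : ℝ) ≤ _
    rcases hr with hr | hr
    · right; linarith
    · left; linarith
  · rw [abs_of_nonneg χ.nonneg]
    exact χ.le_one

/-- The phase `t ω_{ε,κ}` of the propagator as a function of the radial frequency. -/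
noncomputable def propagatorPhase (κ ε t r : ℝ) : ℝ :=
  t * ((1 / ε) * r * √(1 + ε ^ 2 * κ ^ 2 * r ^ 2))

lemma contDiff_propagatorPhase (κ ε t : ℝ) : ContDiff ℝ (⊤ : ℕ∞) (propagatorPhase κ ε t) := by
  unfold propagatorPhase
  refine contDiff_const.mul ((contDiff_const.mul contDiff_id).mul (ContDiff.sqrt ?_ fun r => ?_))
  · fun_prop
  · positivity

lemma exists_schwartz_propagator {E : Type*} [NormedAddCommGroup E] [InnerProductSpace ℝ E]
    [FiniteDimensional ℝ E] {χ : ℝ → ℝ} (hχ : ContDiff ℝ (⊤ : ℕ∞) χ)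
    (hχ₀ : ∀ r, r < 1 / 4 ∨ 9 / 4 < r → χ r = 0) (κ ε t : ℝ) {R : ℝ} (hR : 0 < R) :
    ∃ M : SchwartzMap E ℂ, ∀ ξ, M ξ =
      (χ (‖ξ‖ / R) : ℂ) * Complex.exp (Complex.I * (propagatorPhase κ ε t ‖ξ‖ : ℝ)) := by
  have hcs : HasCompactSupport (fun ξ : E =>
      (χ (‖ξ‖ / R) : ℂ) * Complex.exp (Complex.I * (propagatorPhase κ ε t ‖ξ‖ : ℝ))) := by
    refine HasCompactSupport.intro (isCompact_closedBall 0 (9 / 4 * R)) fun ξ hξ => ?_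
    have : 9 / 4 * R < ‖ξ‖ := by simpa using hξ
    rw [hχ₀ _ (Or.inr ((lt_div_iff₀ hR).mpr this))]
    simp
  have hsm : ContDiff ℝ (⊤ : ℕ∞) (fun ξ : E =>
      (χ (‖ξ‖ / R) : ℂ) * Complex.exp (Complex.I * (propagatorPhase κ ε t ‖ξ‖ : ℝ))) := by
    rw [contDiff_iff_contDiffAt]
    intro ξ
    by_cases hξ : ξ = 0
    · have : (fun ξ : E => (χ (‖ξ‖ / R) : ℂ) *
          Complex.exp (Complex.I * (propagatorPhase κ ε t ‖ξ‖ : ℝ))) =ᶠ[nhds ξ] fun _ => 0 := by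
        filter_upwards [Metric.ball_mem_nhds ξ (show 0 < R / 4 by positivity)] with y hy
        have hy' : ‖y‖ < R / 4 := by simpa [hξ] using hy
        rw [hχ₀ _ (Or.inl ((div_lt_iff₀ hR).mpr (by linarith)))]
        simp
      exact contDiffAt_const.congr_of_eventuallyEq this
    · have hn : ContDiffAt ℝ (⊤ : ℕ∞) (fun ξ : E => ‖ξ‖) ξ := contDiffAt_norm ℝ hξ
      have h₁ : ContDiffAt ℝ (⊤ : ℕ∞) (fun ξ : E => χ (‖ξ‖ / R)) ξ :=
        hχ.contDiffAt.comp ξ (hn.div_const R)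
      have h₂ : ContDiffAt ℝ (⊤ : ℕ∞) (fun ξ : E => propagatorPhase κ ε t ‖ξ‖) ξ :=
        (contDiff_propagatorPhase κ ε t).contDiffAt.comp ξ hn
      exact (Complex.ofRealCLM.contDiff.contDiffAt.comp ξ h₁).mul
        ((contDiffAt_const.mul (Complex.ofRealCLM.contDiff.contDiffAt.comp ξ h₂)).cexp)
  exact ⟨hcs.toSchwartzMap hsm, fun ξ => rfl⟩

lemma propagatorPhase_eq_bogPhase {κ ε t R : ℝ} (hκ : 0 < κ) (hε : 0 < ε) (hR : 0 < R) (r : ℝ) :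
    propagatorPhase κ ε t (R * r) =
      t * R / ε * √(1 + (ε * κ * R) ^ 2) *
        bogPhase ((ε * κ * R) ^ 2 / (1 + (ε * κ * R) ^ 2)) r := by
  have hμ : 0 < ε * κ * R := by positivity
  set μ := ε * κ * R with hμ'
  have h : √(1 + ε ^ 2 * κ ^ 2 * (R * r) ^ 2) =
      √(1 + μ ^ 2) * √(1 - μ ^ 2 / (1 + μ ^ 2) + μ ^ 2 / (1 + μ ^ 2) * r ^ 2) := by
    rw [← Real.sqrt_mul (by positivity)]
    congr 1
    rw [hμ']
    field_simp
    ring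
  rw [propagatorPhase, bogPhase, h]
  field_simp

lemma propagator_scaling_bound {n : ℕ} {κ ε t R δ : ℝ} (hκ : 0 < κ) (hε : 0 < ε) (hR : 0 < R)
    (ht : 0 < t) (hδ₀ : 0 ≤ δ) (hδ : δ ≤ n / 2) :
    R ^ (n + 2) * ((t * R / ε * √(1 + (ε * κ * R) ^ 2)) ^ (-(((n : ℝ) + 2) / 2)) /
        √((ε * κ * R) ^ 2 / (1 + (ε * κ * R) ^ 2))) ≤
      κ ^ (-(((n : ℝ) + 2) / 2)) * κ ^ δ * (t ^ (-(((n : ℝ) + 2) / 2)) * (ε * R) ^ δ) := by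
  have hμ : 0 < ε * κ * R := by positivity
  set μ := ε * κ * R with hμ'
  have hw : 0 < √(1 + μ ^ 2) := by positivity
  have hw₁ : 1 ≤ √(1 + μ ^ 2) := Real.one_le_sqrt.mpr (by nlinarith)
  have hwμ : μ ≤ √(1 + μ ^ 2) := Real.le_sqrt_of_sq_le (by linarith)
  set s := μ / √(1 + μ ^ 2) with hs'
  have hs : 0 < s := by positivity
  have hs₁ : s ≤ 1 := (div_le_one hw).mpr hwμ
  have hsμ : s ≤ μ := div_le_self hμ.le hw₁
  have e₁ : √(μ ^ 2 / (1 + μ ^ 2)) = s := by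
    rw [Real.sqrt_div (by positivity), Real.sqrt_sq hμ.le]
  have e₂ : t * R / ε * √(1 + μ ^ 2) = κ * t * R ^ 2 * s⁻¹ := by
    rw [hs', inv_div]
    field_simp
    rw [hμ']
    ring
  have e₃ : (R ^ 2) ^ (-(((n : ℝ) + 2) / 2)) = (R ^ (n + 2))⁻¹ := by
    rw [← Real.rpow_natCast R 2, ← Real.rpow_natCast R (n + 2), ← Real.rpow_mul hR.le,
      ← Real.rpow_neg hR.le]
    congr 1
    push_cast
    ring
  have e₄ : s⁻¹ ^ (-(((n : ℝ) + 2) / 2)) / s = s ^ ((n : ℝ) / 2) := by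
    rw [Real.inv_rpow hs.le, Real.rpow_neg hs.le, inv_inv,
      show ((n : ℝ) + 2) / 2 = n / 2 + 1 by ring, Real.rpow_add_one hs.ne']
    field_simp
  have e₅ : s ^ ((n : ℝ) / 2) ≤ κ ^ δ * (ε * R) ^ δ := by
    rw [← Real.mul_rpow hκ.le (by positivity)]
    calc s ^ ((n : ℝ) / 2) ≤ s ^ δ := Real.rpow_le_rpow_of_exponent_ge hs hs₁ hδ
      _ ≤ μ ^ δ := Real.rpow_le_rpow hs.le hsμ hδ₀
      _ = (κ * (ε * R)) ^ δ := by rw [hμ']; ring_nf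
  rw [e₁, e₂, Real.mul_rpow (by positivity) (by positivity), Real.mul_rpow (by positivity)
    (by positivity), Real.mul_rpow hκ.le ht.le, e₃, mul_div_assoc, e₄]
  calc _ = κ ^ (-(((n : ℝ) + 2) / 2)) * t ^ (-(((n : ℝ) + 2) / 2)) * s ^ ((n : ℝ) / 2) := by
        field_simp
    _ ≤ κ ^ (-(((n : ℝ) + 2) / 2)) * t ^ (-(((n : ℝ) + 2) / 2)) * (κ ^ δ * (ε * R) ^ δ) := by
        gcongr
    _ = _ := by ring

/-- The `L¹ → L^∞` dispersive bound: pointwise decay of the frequency-localized kernel. -/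
lemma exists_norm_fourierInv_propagator_le (n : ℕ) {χ : ℝ → ℝ} (hχ : ContDiff ℝ (⊤ : ℕ∞) χ)
    (hχ₀ : ∀ r, r < 1 / 4 ∨ 9 / 4 < r → χ r = 0) {κ δ : ℝ} (hκ : 0 < κ) (hδ₀ : 0 ≤ δ)
    (hδ : δ ≤ n / 2) :
    ∃ C : ℝ, 0 ≤ C ∧ ∀ ε R t : ℝ, 0 < ε → 0 < R → 0 < t →
      ∀ x : EuclideanSpace ℝ (Fin (n + 2)),
        ‖𝓕⁻ (fun ξ : EuclideanSpace ℝ (Fin (n + 2)) => (χ (‖ξ‖ / R) : ℂ) *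
          Complex.exp (Complex.I * (propagatorPhase κ ε t ‖ξ‖ : ℝ))) x‖ ≤
        C * (t ^ (-(((n : ℝ) + 2) / 2)) * (ε * R) ^ δ) := by
  have hk : ContDiff ℝ (⊤ : ℕ∞) (fun r => r ^ (n + 1) * χ r) := (contDiff_id.pow _).mul hχ
  obtain ⟨C, hC, h⟩ := exists_bogPhase_decay n hk fun r hr => by rw [hχ₀ r hr, mul_zero]
  set c : ℝ := (n + 1 : ℕ) * (volume.real (Metric.ball (0 : EuclideanSpace ℝ (Fin (n + 1))) 1))
    with hc'
  have hc : 0 ≤ c := by positivity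
  refine ⟨c * C * (κ ^ (-(((n : ℝ) + 2) / 2)) * κ ^ δ), by positivity,
    fun ε R t hε hR ht x => ?_⟩
  have hμ : 0 < ε * κ * R := by positivity
  set L := t * R / ε * √(1 + (ε * κ * R) ^ 2) with hL
  set m := (ε * κ * R) ^ 2 / (1 + (ε * κ * R) ^ 2) with hm
  have hLpos : 0 < L := by positivity
  have hmem : m ∈ Set.Ioc (0 : ℝ) 1 := ⟨by positivity, (div_le_one (by positivity)).mpr (by linarith)⟩
  have hG : Continuous fun r : ℝ =>
      (χ (r / R) : ℂ) * Complex.exp (Complex.I * (propagatorPhase κ ε t r : ℝ)) := by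
    have h₁ := hχ.continuous
    have h₂ := (contDiff_propagatorPhase κ ε t).continuous
    fun_prop
  have hrad := integral_radial_mul_exp_inner n hG (B := 3 * R) (by positivity)
    (fun r hr => by
      rw [hχ₀ _ (Or.inr ((lt_div_iff₀ hR).mpr (by linarith)))]
      simp) ((2 * Real.pi) • x)
  have hF : 𝓕⁻ (fun ξ : EuclideanSpace ℝ (Fin (n + 2)) => (χ (‖ξ‖ / R) : ℂ) *
          Complex.exp (Complex.I * (propagatorPhase κ ε t ‖ξ‖ : ℝ))) x =
      (c : ℂ) * (R ^ (n + 2) : ℝ) * ∫ r in (1 / 8 : ℝ)..3, (((r ^ (n + 1) * χ r : ℝ) : ℂ) *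
        Complex.exp (Complex.I * (L * bogPhase m r : ℝ))) *
        cosIntegral (fun θ => Real.sin θ ^ n) (r * (R * ‖(2 * Real.pi) • x‖)) := by
    rw [Real.fourierInv_eq']
    trans ∫ ξ : EuclideanSpace ℝ (Fin (n + 2)), (χ (‖ξ‖ / R) : ℂ) *
          Complex.exp (Complex.I * (propagatorPhase κ ε t ‖ξ‖ : ℝ)) *
          Complex.exp (Complex.I * (inner ℝ ((2 * Real.pi) • x) ξ : ℝ))
    · congr 1
      ext ξ
      rw [smul_eq_mul, mul_comm, inner_smul_left, real_inner_comm]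
      simp only [conj_trivial]
      rw [mul_comm Complex.I (((2 * Real.pi * inner ℝ x ξ : ℝ)) : ℂ)]
    rw [hrad, mul_assoc]
    congr 1
    have hsub := intervalIntegral.integral_comp_mul_left (a := 0) (b := 3) (c := R)
      (fun r : ℝ => ((r ^ (n + 1) : ℝ) : ℂ) * ((χ (r / R) : ℂ) *
        Complex.exp (Complex.I * (propagatorPhase κ ε t r : ℝ))) *
        cosIntegral (fun θ => Real.sin θ ^ n) (r * ‖(2 * Real.pi) • x‖)) hR.ne'
    rw [mul_zero, mul_comm R 3, eq_inv_smul_iff₀ hR.ne'] at hsub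
    rw [← hsub]
    have hcont : Continuous fun r : ℝ => (((r ^ (n + 1) * χ r : ℝ) : ℂ) *
        Complex.exp (Complex.I * (L * bogPhase m r : ℝ))) *
        cosIntegral (fun θ => Real.sin θ ^ n) (r * (R * ‖(2 * Real.pi) • x‖)) := by
      have h₁ := hχ.continuous
      have h₂ := continuous_bogPhase m
      have h₃ := continuous_cosIntegral (w := fun θ => Real.sin θ ^ n) (by fun_prop)
      fun_prop
    have hzero : ∫ r in (0 : ℝ)..(1 / 8), (((r ^ (n + 1) * χ r : ℝ) : ℂ) *
        Complex.exp (Complex.I * (L * bogPhase m r : ℝ))) *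
        cosIntegral (fun θ => Real.sin θ ^ n) (r * (R * ‖(2 * Real.pi) • x‖)) = 0 := by
      rw [intervalIntegral.integral_congr (g := fun _ => 0), intervalIntegral.integral_zero]
      intro r hr
      rw [Set.uIcc_of_le (by norm_num)] at hr
      simp [hχ₀ r (Or.inl (by linarith [hr.2]))]
    rw [← zero_add (∫ r in (1 / 8 : ℝ)..3, _), ← hzero,
      intervalIntegral.integral_add_adjacent_intervals (hcont.intervalIntegrable _ _)
        (hcont.intervalIntegrable _ _), ← intervalIntegral.integral_const_mul,
      ← intervalIntegral.integral_smul]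
    congr 1
    ext r
    rw [propagatorPhase_eq_bogPhase hκ hε hR, mul_div_cancel_left₀ _ hR.ne', Complex.real_smul,
      ← hL, ← hm, show R * r * ‖(2 * Real.pi) • x‖ = r * (R * ‖(2 * Real.pi) • x‖) by ring]
    push_cast
    ring
  rw [hF, norm_mul, norm_mul, Complex.norm_real, Complex.norm_real, Real.norm_of_nonneg hc,
    Real.norm_of_nonneg (by positivity)]
  calc _ ≤ c * R ^ (n + 2) * (C * L ^ (-(((n : ℝ) + 2) / 2)) / √m) := by
        gcongr
        exact h L hLpos m hmem _ (by positivity)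
    _ = c * C * (R ^ (n + 2) * (L ^ (-(((n : ℝ) + 2) / 2)) / √m)) := by ring
    _ ≤ c * C * (κ ^ (-(((n : ℝ) + 2) / 2)) * κ ^ δ *
          (t ^ (-(((n : ℝ) + 2) / 2)) * (ε * R) ^ δ)) := by
        exact mul_le_mul_of_nonneg_left (propagator_scaling_bound hκ hε hR ht hδ₀ hδ)
          (by positivity)
    _ = _ := by ring

section SchwartzConv

variable {E : Type*} [NormedAddCommGroup E] [InnerProductSpace ℝ E] [FiniteDimensional ℝ E]
  [MeasurableSpace E] [BorelSpace E]

/-- Convolution of a function with a Schwartz kernel. -/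
noncomputable def schwartzConv (K : SchwartzMap E ℂ) (g : E → ℂ) (x : E) : ℂ :=
  ∫ y, g y * K (x - y)

lemma schwartzConv_eq_convolution (K : SchwartzMap E ℂ) (g : E → ℂ) :
    schwartzConv K g = convolution g K (ContinuousLinearMap.mul ℂ ℂ) volume := rfl

lemma schwartzConv_schwartz (K g : SchwartzMap E ℂ) :
    schwartzConv K g = SchwartzMap.convolution (ContinuousLinearMap.mul ℂ ℂ) g K := by
  ext x
  rw [SchwartzMap.convolution_apply, schwartzConv_eq_convolution]

lemma schwartzConv_eq_fourierInv (K g : SchwartzMap E ℂ) :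
    schwartzConv K g = 𝓕⁻ (fun ξ => 𝓕 (⇑g) ξ * 𝓕 (⇑K) ξ) := by
  rw [schwartzConv_schwartz]
  have h := SchwartzMap.fourier_convolution (ContinuousLinearMap.mul ℂ ℂ) g K
  have h' : SchwartzMap.convolution (ContinuousLinearMap.mul ℂ ℂ) g K =
      𝓕⁻ (SchwartzMap.pairing (ContinuousLinearMap.mul ℂ ℂ) (𝓕 g) (𝓕 K)) := by
    rw [← h]
    exact (FourierTransform.fourierInv_fourier_eq _).symm
  rw [h', SchwartzMap.fourierInv_coe]
  rfl

lemma SchwartzMap.eLpNorm_two_fourier (g : SchwartzMap E ℂ) :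
    eLpNorm (𝓕 (⇑g)) 2 volume = eLpNorm g 2 volume := by
  have h := SchwartzMap.norm_fourier_toL2_eq g
  rw [SchwartzMap.norm_toLp, SchwartzMap.norm_toLp] at h
  have h₁ : eLpNorm (𝓕 g : SchwartzMap E ℂ) 2 volume ≠ ∞ := ((𝓕 g : SchwartzMap E ℂ).memLp 2 volume).eLpNorm_ne_top
  have h₂ : eLpNorm g 2 volume ≠ ∞ := (g.memLp 2 volume).eLpNorm_ne_top
  rw [← SchwartzMap.fourier_coe, ← ENNReal.ofReal_toReal h₁, h, ENNReal.ofReal_toReal h₂]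

lemma eLpNorm_two_schwartzConv_schwartz_le {K : SchwartzMap E ℂ} (hK : ∀ ξ, ‖𝓕 (⇑K) ξ‖ ≤ 1)
    (g : SchwartzMap E ℂ) : eLpNorm (schwartzConv K g) 2 volume ≤ eLpNorm g 2 volume := by
  have h := SchwartzMap.fourier_convolution (ContinuousLinearMap.mul ℂ ℂ) g K
  set u : SchwartzMap E ℂ := SchwartzMap.convolution (ContinuousLinearMap.mul ℂ ℂ) g K with hu
  have hu' : schwartzConv K g = u := schwartzConv_schwartz K g
  rw [hu', ← SchwartzMap.eLpNorm_two_fourier u, ← SchwartzMap.eLpNorm_two_fourier g]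
  have hpt : ∀ ξ, 𝓕 (⇑u) ξ = 𝓕 (⇑g) ξ * 𝓕 (⇑K) ξ := fun ξ => by
    change (𝓕 u) ξ = (𝓕 g) ξ * (𝓕 K) ξ
    rw [h, SchwartzMap.pairing_apply_apply, ContinuousLinearMap.mul_apply']
  refine eLpNorm_mono fun ξ => ?_
  rw [hpt, norm_mul]
  exact mul_le_of_le_one_right (norm_nonneg _) (hK ξ)

lemma integrable_mul_schwartz_sub (K : SchwartzMap E ℂ) {g : E → ℂ} (hg : Integrable g) (x : E) :
    Integrable (fun y => g y * K (x - y)) := by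
  refine hg.mul_bdd (c := SchwartzMap.seminorm ℝ 0 0 K) ?_ ?_
  · exact (K.continuous.comp (continuous_const.sub continuous_id)).aestronglyMeasurable
  · exact Filter.Eventually.of_forall fun y => SchwartzMap.norm_le_seminorm ℝ K _

lemma continuous_schwartzConv (K : SchwartzMap E ℂ) {g : E → ℂ} (hg : Integrable g) :
    Continuous (schwartzConv K g) := by
  rw [schwartzConv_eq_convolution]
  refine BddAbove.continuous_convolution_right_of_integrable _ ?_ hg K.continuous
  exact ⟨SchwartzMap.seminorm ℝ 0 0 K, fun x ⟨y, hy⟩ => hy ▸ SchwartzMap.norm_le_seminorm ℝ K y⟩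

lemma schwartzConv_add (K : SchwartzMap E ℂ) {g h : E → ℂ} (hg : Integrable g)
    (hh : Integrable h) (x : E) :
    schwartzConv K (g + h) x = schwartzConv K g x + schwartzConv K h x := by
  unfold schwartzConv
  rw [← integral_add (integrable_mul_schwartz_sub K hg x) (integrable_mul_schwartz_sub K hh x)]
  simp only [Pi.add_apply, add_mul]

lemma schwartzConv_sub (K : SchwartzMap E ℂ) {g h : E → ℂ} (hg : Integrable g)
    (hh : Integrable h) (x : E) :
    schwartzConv K (g - h) x = schwartzConv K g x - schwartzConv K h x := by
  unfold schwartzConv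
  rw [← integral_sub (integrable_mul_schwartz_sub K hg x) (integrable_mul_schwartz_sub K hh x)]
  simp only [Pi.sub_apply, sub_mul]

lemma norm_schwartzConv_le {K : SchwartzMap E ℂ} {A : ℝ} (hA : ∀ x, ‖K x‖ ≤ A) {g : E → ℂ}
    (hg : Integrable g) (x : E) : ‖schwartzConv K g x‖ ≤ A * ∫ y, ‖g y‖ := by
  rw [← integral_const_mul]
  refine norm_integral_le_of_norm_le (hg.norm.const_mul A) (Filter.Eventually.of_forall fun y => ?_)
  rw [norm_mul, mul_comm]
  exact mul_le_mul_of_nonneg_right (hA _) (norm_nonneg _)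

lemma enorm_schwartzConv_le_eLpNorm_two (K : SchwartzMap E ℂ) {g : E → ℂ}
    (hg : AEStronglyMeasurable g volume) (x : E) :
    ‖schwartzConv K g x‖ₑ ≤ eLpNorm g 2 volume * eLpNorm K 2 volume := by
  have hm : MeasurePreserving (fun y => x - y) (volume : Measure E) volume :=
    Measure.measurePreserving_sub_left volume x
  have hK : AEStronglyMeasurable (fun y => K (x - y)) volume :=
    (K.continuous.comp (continuous_const.sub continuous_id)).aestronglyMeasurable
  have hKn : eLpNorm (fun y => K (x - y)) 2 volume = eLpNorm K 2 volume :=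
    eLpNorm_comp_measurePreserving K.continuous.aestronglyMeasurable hm
  rw [← hKn]
  calc ‖schwartzConv K g x‖ₑ ≤ ∫⁻ y, ‖g y * K (x - y)‖ₑ := enorm_integral_le_lintegral_enorm _
    _ = eLpNorm (g • fun y => K (x - y)) 1 volume := by
        rw [eLpNorm_one_eq_lintegral_enorm]
        rfl
    _ ≤ _ := eLpNorm_smul_le_mul_eLpNorm hK hg

lemma exists_schwartz_eLpNorm_sub_le {g : E → ℂ} (hg : MemLp g 2 volume) {r : ℝ≥0∞} (hr : 0 < r) :
    ∃ s : SchwartzMap E ℂ, eLpNorm (g - ⇑s) 2 volume < r := by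
  have hd : DenseRange (SchwartzMap.toLpCLM ℝ ℂ 2 (volume : Measure E)) :=
    SchwartzMap.denseRange_toLpCLM (by simp)
  obtain ⟨_, ⟨s, rfl⟩, hs⟩ := EMetric.mem_closure_iff.mp (hd (hg.toLp g)) r hr
  refine ⟨s, ?_⟩
  rwa [SchwartzMap.toLpCLM_apply, SchwartzMap.toLp, Lp.edist_toLp_toLp] at hs

/-- Convolution with a kernel whose Fourier transform is bounded by one contracts `L²`. -/
lemma eLpNorm_two_schwartzConv_le {K : SchwartzMap E ℂ} (hK : ∀ ξ, ‖𝓕 (⇑K) ξ‖ ≤ 1)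
    {g : E → ℂ} (hg : Integrable g) (hg₂ : MemLp g 2 volume) :
    eLpNorm (schwartzConv K g) 2 volume ≤ eLpNorm g 2 volume := by
  have hex : ∀ n : ℕ, ∃ s : SchwartzMap E ℂ, eLpNorm (g - ⇑s) 2 volume < ((n : ℝ≥0∞) + 1)⁻¹ :=
    fun n => exists_schwartz_eLpNorm_sub_le hg₂ (by simp)
  choose s hs using hex
  have hinv : Filter.Tendsto (fun n : ℕ => ((n : ℝ≥0∞) + 1)⁻¹) Filter.atTop (nhds 0) := by
    have := (Filter.tendsto_add_atTop_iff_nat 1).mpr ENNReal.tendsto_inv_nat_nhds_zero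
    simpa using this
  have hlim : ∀ x, Filter.Tendsto (fun n => schwartzConv K (s n) x) Filter.atTop
      (nhds (schwartzConv K g x)) := by
    intro x
    rw [tendsto_iff_edist_tendsto_0]
    have hz : Filter.Tendsto (fun n : ℕ => ((n : ℝ≥0∞) + 1)⁻¹ * eLpNorm K 2 volume)
        Filter.atTop (nhds 0) := by
      simpa using ENNReal.Tendsto.mul_const hinv (Or.inr (K.memLp 2 volume).eLpNorm_ne_top)
    have hle : ∀ n, edist (schwartzConv K (s n) x) (schwartzConv K g x) ≤
        ((n : ℝ≥0∞) + 1)⁻¹ * eLpNorm K 2 volume := fun n => by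
      rw [edist_comm, edist_eq_enorm_sub, ← schwartzConv_sub K hg (s n).integrable]
      exact (enorm_schwartzConv_le_eLpNorm_two K
        (hg₂.1.sub (s n).continuous.aestronglyMeasurable) x).trans
        (mul_le_mul_left (hs n).le _)
    exact tendsto_of_tendsto_of_tendsto_of_le_of_le tendsto_const_nhds hz
      (fun _ => zero_le) hle
  refine (Lp.eLpNorm_lim_le_liminf_eLpNorm (fun n =>
    (continuous_schwartzConv K (s n).integrable).aestronglyMeasurable) _
    (Filter.Eventually.of_forall hlim)).trans ?_
  have hbound : ∀ n, eLpNorm (schwartzConv K (s n)) 2 volume ≤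
      eLpNorm g 2 volume + ((n : ℝ≥0∞) + 1)⁻¹ := by
    intro n
    refine (eLpNorm_two_schwartzConv_schwartz_le hK (s n)).trans ?_
    have : (⇑(s n) : E → ℂ) = g - (g - ⇑(s n)) := by simp
    rw [this]
    refine (eLpNorm_sub_le hg₂.1 (hg₂.1.sub (s n).continuous.aestronglyMeasurable)
      (by norm_num)).trans ?_
    gcongr
    exact (hs n).le
  have htend : Filter.Tendsto (fun n : ℕ => eLpNorm g 2 volume + ((n : ℝ≥0∞) + 1)⁻¹)
      Filter.atTop (nhds (eLpNorm g 2 volume)) := by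
    simpa using hinv.const_add (eLpNorm g 2 volume)
  rw [← htend.liminf_eq]
  exact Filter.liminf_le_liminf (Filter.Eventually.of_forall hbound)

end SchwartzConv

section Interpolation

variable {E : Type*} [NormedAddCommGroup E] [InnerProductSpace ℝ E] [FiniteDimensional ℝ E]
  [MeasurableSpace E] [BorelSpace E]

lemma integral_indicator_norm_le_rpow (f : SchwartzMap E ℂ) {p s : ℝ} (hp : 1 ≤ p) (hs : 0 < s) :
    ∫ y, ‖{y | s < ‖f y‖}.indicator f y‖ ≤ s ^ (1 - p) * ∫ y, ‖f y‖ ^ p := by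
  have hp₀ : 0 < p := by linarith
  have hint : Integrable (fun y => ‖f y‖ ^ p) volume := by
    have := (f.memLp (ENNReal.ofReal p) volume).integrable_norm_rpow (by simpa using hp₀) (by simp)
    rwa [ENNReal.toReal_ofReal hp₀.le] at this
  rw [← integral_const_mul]
  refine integral_mono_of_nonneg (Filter.Eventually.of_forall fun y => norm_nonneg _)
    (hint.const_mul _) (Filter.Eventually.of_forall fun y => ?_)
  simp only
  by_cases hy : s < ‖f y‖
  · rw [Set.indicator_of_mem (show y ∈ {y | s < ‖f y‖} from hy)]
    have hf : 0 < ‖f y‖ := hs.trans hy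
    calc ‖f y‖ = ‖f y‖ ^ (1 - p) * ‖f y‖ ^ p := by
          rw [← Real.rpow_add hf, sub_add_cancel, Real.rpow_one]
      _ ≤ s ^ (1 - p) * ‖f y‖ ^ p := by
          have hp' : 1 - p ≤ 0 := by linarith
          exact mul_le_mul_of_nonneg_right (Real.rpow_le_rpow_of_nonpos hs hy.le hp')
            (by positivity)
  · rw [Set.indicator_of_notMem (show y ∉ {y | s < ‖f y‖} from hy), norm_zero]
    positivity

/-- The weak-type bound obtained from splitting at height `s`. -/
lemma volume_lt_norm_schwartzConv_le {K : SchwartzMap E ℂ} (hK : ∀ ξ, ‖𝓕 (⇑K) ξ‖ ≤ 1)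
    {A : ℝ} (hA : ∀ x, ‖K x‖ ≤ A) (f : SchwartzMap E ℂ) {p s l : ℝ} (hp : 1 ≤ p) (hs : 0 < s)
    (hl : 0 < l) (hsl : A * (s ^ (1 - p) * ∫ y, ‖f y‖ ^ p) ≤ l / 2) :
    volume {x | l < ‖schwartzConv K f x‖} ≤
      ∫⁻ x, {x | ‖f x‖ ≤ s}.indicator (fun x => ENNReal.ofReal (4 * l⁻¹ ^ 2 * ‖f x‖ ^ 2)) x := by
  have hA₀ : 0 ≤ A := (norm_nonneg _).trans (hA 0)
  have hms : MeasurableSet {x | ‖f x‖ ≤ s} :=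
    measurableSet_le f.continuous.norm.measurable measurable_const
  have hms' : MeasurableSet {x | s < ‖f x‖} :=
    measurableSet_lt measurable_const f.continuous.norm.measurable
  set f₁ : E → ℂ := {x | s < ‖f x‖}.indicator f with hf₁
  set f₂ : E → ℂ := {x | ‖f x‖ ≤ s}.indicator f with hf₂
  have hi₁ : Integrable f₁ := f.integrable.indicator hms'
  have hi₂ : Integrable f₂ := f.integrable.indicator hms
  have hm₂ : MemLp f₂ 2 volume := (f.memLp 2 volume).indicator hms
  have hsum : (⇑f : E → ℂ) = f₁ + f₂ := by
    ext x
    by_cases hx : s < ‖f x‖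
    · simp [hf₁, hf₂, hx, not_le.mpr hx]
    · simp [hf₁, hf₂, hx, not_lt.mp hx]
  have hsub : {x | l < ‖schwartzConv K f x‖} ⊆
      {x | ENNReal.ofReal ((l / 2) ^ 2) ≤ ‖schwartzConv K f₂ x‖ₑ ^ 2} := by
    intro x hx
    have hx' : l < ‖schwartzConv K f x‖ := hx
    rw [hsum, schwartzConv_add K hi₁ hi₂] at hx'
    have h₁ : ‖schwartzConv K f₁ x‖ ≤ l / 2 :=
      (norm_schwartzConv_le hA hi₁ x).trans ((mul_le_mul_of_nonneg_left
        (integral_indicator_norm_le_rpow f hp hs) hA₀).trans hsl)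
    have h₂ : l / 2 ≤ ‖schwartzConv K f₂ x‖ := by
      have := norm_add_le (schwartzConv K f₁ x) (schwartzConv K f₂ x)
      linarith
    change ENNReal.ofReal ((l / 2) ^ 2) ≤ ‖schwartzConv K f₂ x‖ₑ ^ 2
    rw [← ofReal_norm, ← ENNReal.ofReal_pow (norm_nonneg _)]
    exact ENNReal.ofReal_le_ofReal (by gcongr)
  have hcheb := mul_meas_ge_le_lintegral (μ := volume)
    (f := fun x => ‖schwartzConv K f₂ x‖ₑ ^ 2)
    ((continuous_schwartzConv K hi₂).measurable.enorm.pow_const 2) (ENNReal.ofReal ((l / 2) ^ 2))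
  have hL2 : ∫⁻ x, ‖schwartzConv K f₂ x‖ₑ ^ 2 ≤ ∫⁻ x, ‖f₂ x‖ₑ ^ 2 := by
    have h := eLpNorm_two_schwartzConv_le hK hi₂ hm₂
    have h' := ENNReal.rpow_le_rpow h (show (0 : ℝ) ≤ 2 by norm_num)
    have e : ∀ g : E → ℂ, eLpNorm g 2 volume ^ (2 : ℝ) = ∫⁻ x, ‖g x‖ₑ ^ 2 := fun g => by
      rw [eLpNorm_eq_lintegral_rpow_enorm_toReal (by norm_num) (by norm_num), ← ENNReal.rpow_mul]
      norm_num
    rwa [e, e] at h'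
  have hl₂ : ENNReal.ofReal (4 * l⁻¹ ^ 2) * ENNReal.ofReal ((l / 2) ^ 2) = 1 := by
    rw [← ENNReal.ofReal_mul (by positivity), ← ENNReal.ofReal_one]
    congr 1
    field_simp
    norm_num
  calc volume {x | l < ‖schwartzConv K f x‖}
      ≤ volume {x | ENNReal.ofReal ((l / 2) ^ 2) ≤ ‖schwartzConv K f₂ x‖ₑ ^ 2} :=
        measure_mono hsub
    _ = ENNReal.ofReal (4 * l⁻¹ ^ 2) * (ENNReal.ofReal ((l / 2) ^ 2) *
          volume {x | ENNReal.ofReal ((l / 2) ^ 2) ≤ ‖schwartzConv K f₂ x‖ₑ ^ 2}) := by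
        rw [← mul_assoc, hl₂, one_mul]
    _ ≤ ENNReal.ofReal (4 * l⁻¹ ^ 2) * ∫⁻ x, ‖f₂ x‖ₑ ^ 2 := by
        gcongr
        exact hcheb.trans hL2
    _ = ∫⁻ x, {x | ‖f x‖ ≤ s}.indicator
          (fun x => ENNReal.ofReal (4 * l⁻¹ ^ 2 * ‖f x‖ ^ 2)) x := by
        rw [← lintegral_const_mul' _ _ ENNReal.ofReal_ne_top]
        congr 1
        ext x
        by_cases hx : ‖f x‖ ≤ s
        · have hx' : x ∈ {x | ‖f x‖ ≤ s} := hx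
          rw [hf₂, Set.indicator_of_mem hx', Set.indicator_of_mem hx', ← ofReal_norm,
            ← ENNReal.ofReal_pow (norm_nonneg _), ← ENNReal.ofReal_mul (by positivity)]
        · have hx' : x ∉ {x | ‖f x‖ ≤ s} := hx
          rw [hf₂, Set.indicator_of_notMem hx', Set.indicator_of_notMem hx']
          simp

lemma setLIntegral_level_le {q p a c : ℝ} (hq : 2 < q) (hpq : (q - 1) * (p - 1) = 1)
    (ha : 0 ≤ a) (hc : 0 < c) :
    ∫⁻ l in Set.Ioi (0 : ℝ), {l : ℝ | a ≤ (c / l) ^ (q - 1)}.indicator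
        (fun l => ENNReal.ofReal (4 * l⁻¹ ^ 2 * a ^ 2 * l ^ (q - 1))) l ≤
      ENNReal.ofReal (4 / (q - 2) * c ^ (q - 2) * a ^ p) := by
  have hp : 1 < p := by
    by_contra h
    nlinarith
  rcases ha.eq_or_lt with rfl | ha
  · refine le_of_eq_of_le ?_ zero_le
    rw [lintegral_eq_zero_iff' ?_]
    · refine Filter.Eventually.of_forall fun l => ?_
      simp [Set.indicator]
    · refine AEMeasurable.congr (aemeasurable_const (b := 0)) ?_
      refine Filter.Eventually.of_forall fun l => ?_
      simp [Set.indicator]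
  set b := c * a ^ (1 - p) with hb
  have hb₀ : 0 < b := by positivity
  have hint : IntegrableOn (fun l : ℝ => 4 * a ^ 2 * l ^ (q - 3)) (Set.Ioc 0 b) := by
    have := (intervalIntegral.intervalIntegrable_rpow' (a := 0) (b := b)
      (show -1 < q - 3 by linarith)).const_mul (4 * a ^ 2)
    rwa [intervalIntegrable_iff_integrableOn_Ioc_of_le hb₀.le] at this
  calc _ ≤ ∫⁻ l in Set.Ioi (0 : ℝ), (Set.Ioc 0 b).indicator
          (fun l => ENNReal.ofReal (4 * a ^ 2 * l ^ (q - 3))) l := by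
        refine setLIntegral_mono' measurableSet_Ioi fun l hl => ?_
        have hl : 0 < l := hl
        by_cases hal : a ≤ (c / l) ^ (q - 1)
        · have hlb : l ≤ b := by
            have h₁ : a ^ (p - 1) ≤ c / l := by
              have := Real.rpow_le_rpow ha.le hal (show 0 ≤ p - 1 by linarith)
              rwa [← Real.rpow_mul (by positivity), hpq, Real.rpow_one] at this
            rw [le_div_iff₀ hl] at h₁
            rw [hb, show 1 - p = -(p - 1) by ring, Real.rpow_neg ha.le, ← div_eq_mul_inv,
              le_div_iff₀ (by positivity), mul_comm]
            exact h₁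
          rw [Set.indicator_of_mem (show l ∈ {l : ℝ | a ≤ (c / l) ^ (q - 1)} from hal),
            Set.indicator_of_mem (show l ∈ Set.Ioc 0 b from ⟨hl, hlb⟩)]
          apply le_of_eq
          congr 1
          rw [show q - 1 = (q - 3) + 2 by ring, Real.rpow_add hl, Real.rpow_two]
          field_simp
        · rw [Set.indicator_of_notMem (show l ∉ {l : ℝ | a ≤ (c / l) ^ (q - 1)} from hal)]
          exact zero_le
    _ ≤ ∫⁻ l in Set.Ioc 0 b, ENNReal.ofReal (4 * a ^ 2 * l ^ (q - 3)) := by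
        rw [← lintegral_indicator measurableSet_Ioc]
        exact lintegral_mono' Measure.restrict_le_self le_rfl
    _ = ENNReal.ofReal (∫ l in (0 : ℝ)..b, 4 * a ^ 2 * l ^ (q - 3)) := by
        rw [intervalIntegral.integral_of_le hb₀.le, ofReal_integral_eq_lintegral_ofReal hint]
        refine (ae_restrict_iff' measurableSet_Ioc).mpr (Filter.Eventually.of_forall fun l hl => ?_)
        have := hl.1
        simp only [Pi.zero_apply]
        positivity
    _ = ENNReal.ofReal (4 / (q - 2) * c ^ (q - 2) * a ^ p) := by
        congr 1
        rw [intervalIntegral.integral_const_mul, integral_rpow (Or.inl (by linarith)),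
          show q - 3 + 1 = q - 2 by ring, Real.zero_rpow (by linarith), sub_zero, hb,
          Real.mul_rpow hc.le (by positivity), ← Real.rpow_mul ha.le]
        have : a ^ p = a ^ 2 * a ^ ((1 - p) * (q - 2)) := by
          rw [← Real.rpow_two, ← Real.rpow_add ha]
          congr 1
          nlinarith
        rw [this]
        ring

/-- Real interpolation between the `L¹ → L^∞` and the `L²` bound on the line of duality. -/
lemma eLpNorm_schwartzConv_le_of_two_lt {K : SchwartzMap E ℂ} (hK : ∀ ξ, ‖𝓕 (⇑K) ξ‖ ≤ 1)
    {A : ℝ} (hA₀ : 0 < A) (hA : ∀ x, ‖K x‖ ≤ A) (f : SchwartzMap E ℂ) {q p : ℝ} (hq : 2 < q)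
    (hpq : (q - 1) * (p - 1) = 1) :
    eLpNorm (schwartzConv K f) (ENNReal.ofReal q) volume ≤
      ENNReal.ofReal ((q * (4 / (q - 2)) * 2 ^ (q - 2)) ^ (1 / q) * A ^ (1 - 2 / q)) *
        eLpNorm f (ENNReal.ofReal p) volume := by
  have hp : 1 < p := by
    by_contra h
    nlinarith
  have hp₀ : 0 < p := by linarith
  have hq₀ : 0 < q := by linarith
  have hfp : eLpNorm f (ENNReal.ofReal p) volume =
      ENNReal.ofReal ((∫ x, ‖f x‖ ^ p) ^ p⁻¹) := by
    have := (f.memLp (ENNReal.ofReal p) volume).eLpNorm_eq_integral_rpow_norm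
      (by simpa using hp₀) (by simp)
    rwa [ENNReal.toReal_ofReal hp₀.le] at this
  have hint : Integrable (fun y => ‖f y‖ ^ p) volume := by
    have := (f.memLp (ENNReal.ofReal p) volume).integrable_norm_rpow (by simpa using hp₀) (by simp)
    rwa [ENNReal.toReal_ofReal hp₀.le] at this
  set N := ∫ x, ‖f x‖ ^ p with hN
  have hN₀ : 0 ≤ N := integral_nonneg fun x => by positivity
  have hcont := continuous_schwartzConv K f.integrable
  rcases hN₀.eq_or_lt with hN0 | hNpos
  · have hf0 : eLpNorm f (ENNReal.ofReal p) volume = 0 := by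
      rw [hfp, ← hN0, Real.zero_rpow (by positivity), ENNReal.ofReal_zero]
    rw [eLpNorm_eq_zero_iff f.continuous.aestronglyMeasurable (by simpa using hp₀)] at hf0
    have hz : schwartzConv K f = 0 := by
      ext x
      refine integral_eq_zero_of_ae ?_
      filter_upwards [hf0] with y hy
      simp [hy]
    rw [hz, eLpNorm_zero]
    exact zero_le
  set c := 2 * A * N with hc
  have hc₀ : 0 < c := by positivity
  have hweak : ∀ l : ℝ, 0 < l → volume {x | l < ‖schwartzConv K f x‖} ≤
      ∫⁻ x, {x | ‖f x‖ ≤ (c / l) ^ (q - 1)}.indicator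
        (fun x => ENNReal.ofReal (4 * l⁻¹ ^ 2 * ‖f x‖ ^ 2)) x := by
    intro l hl
    refine volume_lt_norm_schwartzConv_le hK hA f hp.le (by positivity) hl ?_
    rw [← Real.rpow_mul (by positivity), show (q - 1) * (1 - p) = -1 by linarith,
      Real.rpow_neg_one, ← hN, hc]
    apply le_of_eq
    field_simp
  have hkey : ∫⁻ x, ENNReal.ofReal (‖schwartzConv K f x‖ ^ q) ≤
      ENNReal.ofReal (q * (4 / (q - 2)) * c ^ (q - 2) * N) := by
    rw [lintegral_rpow_eq_lintegral_meas_lt_mul volume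
      (Filter.Eventually.of_forall fun x => norm_nonneg _) hcont.norm.aemeasurable hq₀]
    have hq2 : 0 < q - 2 := by linarith
    have hmeas : Measurable (fun z : ℝ × E => {z : ℝ × E | ‖f z.2‖ ≤ (c / z.1) ^ (q - 1)}.indicator
        (fun z => ENNReal.ofReal (4 * z.1⁻¹ ^ 2 * ‖f z.2‖ ^ 2 * z.1 ^ (q - 1))) z) := by
      have hf := f.continuous.measurable
      refine Measurable.indicator (by fun_prop) (measurableSet_le (by fun_prop) (by fun_prop))
    calc _ ≤ ENNReal.ofReal q * ∫⁻ l in Set.Ioi (0 : ℝ), ∫⁻ x,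
            {z : ℝ × E | ‖f z.2‖ ≤ (c / z.1) ^ (q - 1)}.indicator
              (fun z => ENNReal.ofReal (4 * z.1⁻¹ ^ 2 * ‖f z.2‖ ^ 2 * z.1 ^ (q - 1))) (l, x) := by
          gcongr 1
          refine setLIntegral_mono' measurableSet_Ioi fun l hl => ?_
          have hl : 0 < l := hl
          refine (mul_le_mul_left (hweak l hl) _).trans (le_of_eq ?_)
          rw [← lintegral_mul_const' _ _ ENNReal.ofReal_ne_top]
          congr 1
          ext x
          by_cases hx : ‖f x‖ ≤ (c / l) ^ (q - 1)
          · simp only [Set.indicator, Set.mem_ofPred_eq, hx, if_true]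
            rw [← ENNReal.ofReal_mul (by positivity)]
          · simp only [Set.indicator, Set.mem_ofPred_eq, hx, if_false, zero_mul]
      _ = ENNReal.ofReal q * ∫⁻ x, ∫⁻ l in Set.Ioi (0 : ℝ),
            {z : ℝ × E | ‖f z.2‖ ≤ (c / z.1) ^ (q - 1)}.indicator
              (fun z => ENNReal.ofReal (4 * z.1⁻¹ ^ 2 * ‖f z.2‖ ^ 2 * z.1 ^ (q - 1))) (l, x) := by
          rw [lintegral_lintegral_swap]
          exact hmeas.aemeasurable
      _ ≤ ENNReal.ofReal q * ∫⁻ x, ENNReal.ofReal (4 / (q - 2) * c ^ (q - 2) * ‖f x‖ ^ p) := by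
          gcongr with x
          exact setLIntegral_level_le hq hpq (norm_nonneg (f x)) hc₀
      _ = ENNReal.ofReal (q * (4 / (q - 2)) * c ^ (q - 2) * N) := by
          rw [← ofReal_integral_eq_lintegral_ofReal (hint.const_mul _)
            (Filter.Eventually.of_forall fun x => by simp only [Pi.zero_apply]; positivity),
            integral_const_mul, ← ENNReal.ofReal_mul hq₀.le, hN]
          congr 1
          ring
  rw [eLpNorm_eq_lintegral_rpow_enorm_toReal (by simpa using hq₀) (by simp),
    ENNReal.toReal_ofReal hq₀.le, hfp, ← ENNReal.ofReal_mul (by positivity)]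
  have henorm : ∀ x, ‖schwartzConv K f x‖ₑ ^ q = ENNReal.ofReal (‖schwartzConv K f x‖ ^ q) :=
    fun x => by rw [← ofReal_norm, ENNReal.ofReal_rpow_of_nonneg (norm_nonneg _) hq₀.le]
  simp only [henorm]
  refine (ENNReal.rpow_le_rpow hkey (by positivity)).trans (le_of_eq ?_)
  have hq2 : 0 < q - 2 := by linarith
  rw [ENNReal.ofReal_rpow_of_nonneg (by positivity) (by positivity)]
  congr 1
  have hpi : p⁻¹ = (q - 2) * (1 / q) + 1 / q := by
    field_simp
    nlinarith
  have hNp : N ^ p⁻¹ = (N ^ (q - 2) * N) ^ (1 / q) := by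
    rw [hpi, Real.rpow_add hNpos, Real.rpow_mul hNpos.le, Real.mul_rpow (by positivity) hNpos.le]
  have hAq : A ^ (1 - 2 / q) = (A ^ (q - 2)) ^ (1 / q) := by
    rw [← Real.rpow_mul hA₀.le]
    congr 1
    field_simp
  have hcq : c ^ (q - 2) = 2 ^ (q - 2) * A ^ (q - 2) * N ^ (q - 2) := by
    rw [hc, Real.mul_rpow (by positivity) hNpos.le, Real.mul_rpow (by norm_num) hA₀.le]
  rw [hNp, hAq, ← Real.mul_rpow (by positivity) (by positivity),
    ← Real.mul_rpow (by positivity) (by positivity), hcq]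
  congr 1
  ring

end Interpolation

/-- The propagator applied to frequency-localized data is a convolution with a Schwartz kernel
that is bounded by the dispersive decay rate and has Fourier transform bounded by one. -/
lemma exists_propagator_kernel (n : ℕ) {κ δ : ℝ} (hκ : 0 < κ) (hδ₀ : 0 ≤ δ) (hδ : δ ≤ n / 2) :
    ∃ C : ℝ, 0 < C ∧ ∀ ε R t : ℝ, 0 < ε → 0 < R → 0 < t →
      ∃ K : SchwartzMap (EuclideanSpace ℝ (Fin (n + 2))) ℂ, (∀ ξ, ‖𝓕 (⇑K) ξ‖ ≤ 1) ∧
        (∀ x, ‖K x‖ ≤ C * (t ^ (-(((n : ℝ) + 2) / 2)) * (ε * R) ^ δ)) ∧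
        ∀ f : SchwartzMap (EuclideanSpace ℝ (Fin (n + 2))) ℂ,
          Function.support (𝓕 ⇑f) ⊆ {ξ | R / 2 ≤ ‖ξ‖ ∧ ‖ξ‖ ≤ 2 * R} →
          (𝓕⁻ fun ξ : EuclideanSpace ℝ (Fin (n + 2)) =>
            Complex.exp (Complex.I * (propagatorPhase κ ε t ‖ξ‖ : ℝ)) * 𝓕 (⇑f) ξ) =
          schwartzConv K f := by
  obtain ⟨χ, hχ, hχ₁, hχ₀, hχb⟩ := exists_annulus_cutoff
  obtain ⟨C, hC, hdecay⟩ := exists_norm_fourierInv_propagator_le n hχ hχ₀ hκ hδ₀ hδ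
  refine ⟨C + 1, by positivity, fun ε R t hε hR ht => ?_⟩
  obtain ⟨M, hM⟩ := exists_schwartz_propagator (E := EuclideanSpace ℝ (Fin (n + 2))) hχ hχ₀ κ ε t hR
  have hFK : 𝓕 (⇑(𝓕⁻ M : SchwartzMap (EuclideanSpace ℝ (Fin (n + 2))) ℂ)) = ⇑M := by
    rw [← SchwartzMap.fourier_coe, FourierTransform.fourier_fourierInv_eq]
  have hMfun : (⇑M : EuclideanSpace ℝ (Fin (n + 2)) → ℂ) = fun ξ =>
      (χ (‖ξ‖ / R) : ℂ) * Complex.exp (Complex.I * (propagatorPhase κ ε t ‖ξ‖ : ℝ)) := funext hM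
  refine ⟨𝓕⁻ M, fun ξ => ?_, fun x => ?_, fun f hf => ?_⟩
  · rw [hFK, hM, norm_mul, Complex.norm_real, Real.norm_eq_abs, mul_comm Complex.I,
      Complex.norm_exp_ofReal_mul_I, mul_one]
    exact hχb _
  · rw [SchwartzMap.fourierInv_coe, hMfun]
    refine (hdecay ε R t hε hR ht x).trans ?_
    have : 0 ≤ t ^ (-(((n : ℝ) + 2) / 2)) * (ε * R) ^ δ := by positivity
    nlinarith
  · rw [schwartzConv_eq_fourierInv, hFK]
    congr 1
    ext ξ
    by_cases hξ : 𝓕 (⇑f) ξ = 0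
    · rw [hξ, mul_zero, zero_mul]
    · have hmem := hf (Function.mem_support.mpr hξ)
      have h₁ : 1 / 2 ≤ ‖ξ‖ / R := by
        rw [le_div_iff₀ hR]
        linarith [hmem.1]
      have h₂ : ‖ξ‖ / R ≤ 2 := (div_le_iff₀ hR).mpr hmem.2
      rw [hM, hχ₁ _ h₁ h₂, Complex.ofReal_one, one_mul, mul_comm]

/-- Pointwise-in-time `L^{q′} → L^q` dispersive estimate for the frequency-localized
Bogoliubov propagator `e^{itH_ε}` (given by the Fourier multiplier
`e^{itω_{ε,κ}(ξ)}` with `ω_{ε,κ}(ξ) = (1/ε)‖ξ‖√(1+ε²κ²‖ξ‖²)`): for `2 ≤ q ≤ ∞` with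
conjugate exponent `q′` and `0 ≤ δ ≤ (d−2)/2`, there is `C > 0` depending only on
`d, κ, q, δ` such that for all `ε, R > 0`, all Schwartz `f` with `𝓕f` supported in the
annulus `{R/2 ≤ ‖ξ‖ ≤ 2R}` and all `t > 0`,
`‖e^{itH_ε}f‖_{L^q} ≤ C t^{−d(1/2−1/q)} (εR)^{δ(1−2/q)} ‖f‖_{L^{q′}}`. -/
theorem stmt_17 (d : ℕ) (hd : 2 ≤ d) (κ : ℝ) (hκ : 0 < κ)
    (q q' : ℝ≥0∞) (hq : 2 ≤ q) (hqq' : 1 / q + 1 / q' = 1)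
    (δ : ℝ) (hδ0 : 0 ≤ δ) (hδ : δ ≤ ((d : ℝ) - 2) / 2) :
    ∃ C : ℝ, 0 < C ∧ ∀ (ε R : ℝ), 0 < ε → 0 < R →
      ∀ f : SchwartzMap (EuclideanSpace ℝ (Fin d)) ℂ,
        Function.support (𝓕 ⇑f) ⊆ {ξ : EuclideanSpace ℝ (Fin d) | R / 2 ≤ ‖ξ‖ ∧ ‖ξ‖ ≤ 2 * R} →
        ∀ t : ℝ, 0 < t →
          eLpNorm (𝓕⁻ fun ξ : EuclideanSpace ℝ (Fin d) =>
              Complex.exp (Complex.I *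
                ((t * ((1 / ε) * ‖ξ‖ * Real.sqrt (1 + ε ^ 2 * κ ^ 2 * ‖ξ‖ ^ 2)) : ℝ) : ℂ)) *
                𝓕 (⇑f) ξ) q volume ≤
            ENNReal.ofReal (C * t ^ (-(d : ℝ) * (1 / 2 - (1 / q).toReal)) *
                (ε * R) ^ (δ * (1 - 2 * (1 / q).toReal))) *
              eLpNorm (⇑f) q' volume := by
  obtain ⟨n, rfl⟩ : ∃ n, d = n + 2 := ⟨d - 2, by omega⟩
  have hδ' : δ ≤ n / 2 := by
    push_cast at hδ
    linarith
  obtain ⟨C, hC, hker⟩ := exists_propagator_kernel n hκ hδ0 hδ'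
  rcases hq.eq_or_lt with rfl | hq2
  · have hq' : q' = 2 := by
      have h : (2 : ℝ≥0∞)⁻¹ + q'⁻¹ = 2⁻¹ + 2⁻¹ := by
        rw [ENNReal.inv_two_add_inv_two]
        simpa using hqq'
      exact inv_injective ((ENNReal.add_right_inj (by simp)).mp h)
    subst hq'
    refine ⟨1, one_pos, fun ε R hε hR f hf t ht => ?_⟩
    obtain ⟨K, hK₁, -, hKf⟩ := hker ε R t hε hR ht
    have e : (1 / (2 : ℝ≥0∞)).toReal = 1 / 2 := by simp
    rw [e, sub_self, mul_zero, Real.rpow_zero, show δ * (1 - 2 * (1 / 2)) = 0 by ring,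
      Real.rpow_zero, mul_one, mul_one, ENNReal.ofReal_one, one_mul]
    refine le_of_eq_of_le (congrArg (fun g => eLpNorm g 2 volume) (hKf f hf)) ?_
    exact eLpNorm_two_schwartzConv_schwartz_le hK₁ f
  by_cases hqt : q = ∞
  · subst hqt
    have hq' : q' = 1 := by
      have h : q'⁻¹ = 1 := by simpa using hqq'
      simpa using h
    subst hq'
    refine ⟨C, hC, fun ε R hε hR f hf t ht => ?_⟩
    obtain ⟨K, -, hK₂, hKf⟩ := hker ε R t hε hR ht
    refine le_of_eq_of_le (congrArg (fun g => eLpNorm g ∞ volume) (hKf f hf)) ?_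
    have hA : 0 ≤ C * (t ^ (-(((n : ℝ) + 2) / 2)) * (ε * R) ^ δ) := by positivity
    have e : C * t ^ (-((n + 2 : ℕ) : ℝ) * (1 / 2 - (1 / (∞ : ℝ≥0∞)).toReal)) *
        (ε * R) ^ (δ * (1 - 2 * (1 / (∞ : ℝ≥0∞)).toReal)) =
        C * (t ^ (-(((n : ℝ) + 2) / 2)) * (ε * R) ^ δ) := by
      have e₁ : (1 / (∞ : ℝ≥0∞)).toReal = 0 := by simp
      rw [e₁, mul_zero, sub_zero, sub_zero, mul_one, mul_assoc]
      push_cast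
      ring_nf
    rw [e, eLpNorm_one_eq_lintegral_enorm, ← ofReal_integral_norm_eq_lintegral_enorm f.integrable,
      ← ENNReal.ofReal_mul hA, eLpNorm_exponent_top]
    refine eLpNormEssSup_le_of_ae_bound (Filter.Eventually.of_forall fun x => ?_)
    exact norm_schwartzConv_le hK₂ f.integrable x
  have hq't : q' ≠ ∞ := by
    rintro rfl
    have h : q = 1 := by simpa using hqq'
    rw [h] at hq2
    exact absurd hq2 (by norm_num)
  have hq'0 : q' ≠ 0 := by
    rintro rfl
    simp at hqq'
  have hq0 : q ≠ 0 := by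
    rintro rfl
    simp at hq2
  set r := q.toReal with hr
  set p := q'.toReal with hp
  have hqr : q = ENNReal.ofReal r := (ENNReal.ofReal_toReal hqt).symm
  have hqp : q' = ENNReal.ofReal p := (ENNReal.ofReal_toReal hq't).symm
  have hr2 : 2 < r := by
    have := (ENNReal.toReal_lt_toReal (by simp) hqt).mpr hq2
    simpa using this
  have hp0 : 0 < p := ENNReal.toReal_pos hq'0 hq't
  have hinv : (1 / q).toReal = 1 / r := by simp [hr]
  have hconj : 1 / r + 1 / p = 1 := by
    have h := congrArg ENNReal.toReal hqq'
    rw [ENNReal.toReal_add (by simp [hq0]) (by simp [hq'0])] at h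
    simpa using h
  have hrp : (r - 1) * (p - 1) = 1 := by
    have hr0 : 0 < r := by linarith
    field_simp at hconj
    linarith
  have hr2' : 0 < r - 2 := by linarith
  have hr0 : 0 < r := by linarith
  refine ⟨(r * (4 / (r - 2)) * 2 ^ (r - 2)) ^ (1 / r) * C ^ (1 - 2 / r), by positivity,
    fun ε R hε hR f hf t ht => ?_⟩
  obtain ⟨K, hK₁, hK₂, hKf⟩ := hker ε R t hε hR ht
  refine le_of_eq_of_le (congrArg (fun g => eLpNorm g q volume) (hKf f hf)) ?_
  have hb := eLpNorm_schwartzConv_le_of_two_lt hK₁ (by positivity) hK₂ f hr2 hrp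
  rw [← hqr, ← hqp] at hb
  refine hb.trans (le_of_eq ?_)
  congr 2
  have hεR : 0 < ε * R := by positivity
  have e : (t ^ (-(((n : ℝ) + 2) / 2)) * (ε * R) ^ δ) ^ (1 - 2 / r) =
      t ^ (-(((n : ℝ) + 2) / 2) * (1 - 2 / r)) * (ε * R) ^ (δ * (1 - 2 / r)) := by
    rw [Real.mul_rpow (by positivity) (by positivity), ← Real.rpow_mul ht.le,
      ← Real.rpow_mul hεR.le]
  rw [hinv, Real.mul_rpow hC.le (by positivity), e, ← mul_assoc, ← mul_assoc]
  congr 3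
  · push_cast
    ring
  · ring
end
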